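/- arXiv:2007.11772 — 14 statements merged into one kernel-verified Lean document; each statement's English description precedes it below -/
import Mathlib

section
/- Let ψ_n : E → ℝ ∪ {+∞} be a proper closed convex function, let ψ_s : E → ℝ be continuously differentiable and satisfy ψ_s(u) − ψ_s(y) − ⟨∇ψ_s(y), u − y⟩ ≤ (M/2)‖u − y‖² for some M > 0 and every u, y ∈ E, and set ψ := ψ_s + ψ_n. Let μ ≥ 0, z ∈ dom ψ_n, v ∈ E, and define z_r := argmin_{u ∈ E} { ⟨∇ψ_s(z) − v, u⟩ + (M/2)‖u − z‖² + ψ_n(u) }. Then Δ_μ(z_r; z, v) ≥ (M/2)‖z_r − z‖², where Δ_μ(u; z, v) := ψ(z) − ψ(u) − ⟨v, z − u⟩ + (μ/2)‖u − z‖². -/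
open RealInnerProductSpace

/-- A real number bounded by `t * K` for all `t ∈ (0, 1]`, with `K ≥ 0`, is nonpositive. -/
lemma nonpos_of_forall_le_mul {x K : ℝ} (hK : 0 ≤ K)
    (h : ∀ t : ℝ, 0 < t → t ≤ 1 → x ≤ t * K) : x ≤ 0 := by
  by_contra! hx
  have hpos : 0 < x + K := by linarith
  have hle := h (x / (x + K)) (div_pos hx hpos) ((div_le_one hpos).2 (by linarith))
  rw [div_mul_eq_mul_div, le_div_iff₀ hpos] at hle
  nlinarith [mul_pos hx hx]

/-- Quadratic growth at a minimizer of `⟪g, ·⟫ + (M/2)‖· - z‖² + ψ` with `ψ` convex along the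
segment from `w` to `z`. -/
lemma inner_add_sq_add_le_of_minimizer {E : Type*} [NormedAddCommGroup E]
    [InnerProductSpace ℝ E] {ψ : E → EReal} {M a b : ℝ} {g z w : E} (hM : 0 ≤ M)
    (ha : ψ z = a) (hb : ψ w = b)
    (hconvex : ∀ t : ℝ, 0 ≤ t → t ≤ 1 →
      ψ (t • z + (1 - t) • w) ≤ ((t : ℝ) : EReal) * ψ z + ((1 - t : ℝ) : EReal) * ψ w)
    (hmin : ∀ u : E,
      ((⟪g, w⟫ + M / 2 * ‖w - z‖ ^ 2 : ℝ) : EReal) + ψ w ≤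
        ((⟪g, u⟫ + M / 2 * ‖u - z‖ ^ 2 : ℝ) : EReal) + ψ u) :
    ⟪g, w - z⟫ + M * ‖w - z‖ ^ 2 + b ≤ a := by
  suffices h : ⟪g, w - z⟫ + M * ‖w - z‖ ^ 2 + b - a ≤ 0 by linarith
  refine nonpos_of_forall_le_mul (K := M / 2 * ‖w - z‖ ^ 2) (by positivity) fun t ht ht1 => ?_
  have h := (hmin (t • z + (1 - t) • w)).trans (add_le_add le_rfl (hconvex t ht.le ht1))
  rw [ha, hb] at h
  have hsub : t • z + (1 - t) • w - z = (1 - t) • (w - z) := by module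
  have hnorm : ‖t • z + (1 - t) • w - z‖ ^ 2 = (1 - t) ^ 2 * ‖w - z‖ ^ 2 := by
    rw [hsub, norm_smul, mul_pow, Real.norm_eq_abs, sq_abs]
  rw [hnorm] at h
  norm_cast at h
  rw [inner_add_right, inner_smul_right, inner_smul_right] at h
  rw [inner_sub_right]
  refine le_of_mul_le_mul_left ?_ ht
  linarith

/-- the refinement procedure output satisfies
`Δ_μ(z_r; z, v) ≥ (M/2)‖z_r − z‖²`, where
`Δ_μ(u; z, v) = ψ(z) − ψ(u) − ⟨v, z − u⟩ + (μ/2)‖u − z‖²` and `ψ = ψ_s + ψ_n`. -/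
theorem stmt_1 {E : Type*} [NormedAddCommGroup E] [InnerProductSpace ℝ E]
    [FiniteDimensional ℝ E]
    (ψn : E → EReal) (ψs : E → ℝ) (M μ : ℝ) (z v zr : E)
    -- ψn is proper
    (hproper : ∃ x, ψn x ≠ ⊤) (hnobot : ∀ x, ψn x ≠ ⊥)
    -- ψn is closed (lower semicontinuous)
    (hclosed : LowerSemicontinuous ψn)
    -- ψn is convex
    (hconvex : ∀ x y : E, ∀ t : ℝ, 0 ≤ t → t ≤ 1 →
      ψn (t • x + (1 - t) • y) ≤ ((t : ℝ) : EReal) * ψn x + ((1 - t : ℝ) : EReal) * ψn y)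
    -- ψs is continuously differentiable with curvature bound M
    (hψs : ContDiff ℝ 1 ψs)
    (hM : 0 < M)
    (hcurv : ∀ u y : E, ψs u - ψs y - ⟪gradient ψs y, u - y⟫ ≤ M / 2 * ‖u - y‖ ^ 2)
    (hμ : 0 ≤ μ)
    -- z ∈ dom ψn
    (hz : ψn z ≠ ⊤)
    -- z_r is the minimizer of u ↦ ⟨∇ψs(z) − v, u⟩ + (M/2)‖u − z‖² + ψn(u)
    (hzr : ∀ u : E,
      ((⟪gradient ψs z - v, zr⟫ + M / 2 * ‖zr - z‖ ^ 2 : ℝ) : EReal) + ψn zr ≤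
        ((⟪gradient ψs z - v, u⟫ + M / 2 * ‖u - z‖ ^ 2 : ℝ) : EReal) + ψn u) :
    -- conclusion: Δ_μ(z_r; z, v) ≥ (M/2)‖z_r − z‖²
    ((M / 2 * ‖zr - z‖ ^ 2 : ℝ) : EReal) ≤
      (((ψs z : ℝ) : EReal) + ψn z) - (((ψs zr : ℝ) : EReal) + ψn zr)
        - ((⟪v, z - zr⟫ : ℝ) : EReal) + ((μ / 2 * ‖zr - z‖ ^ 2 : ℝ) : EReal) := by
  have hzr_top : ψn zr ≠ ⊤ := by
    intro htop
    have h := hzr z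
    rw [htop, EReal.coe_add_top, top_le_iff] at h
    exact EReal.add_ne_top (EReal.coe_ne_top _) hz h
  have ha := (EReal.coe_toReal hz (hnobot z)).symm
  have hb := (EReal.coe_toReal hzr_top (hnobot zr)).symm
  have hgrowth := inner_add_sq_add_le_of_minimizer hM.le ha hb (hconvex z zr) hzr
  have hsmooth := hcurv zr z
  rw [ha, hb]
  norm_cast
  have hμ' : 0 ≤ μ / 2 * ‖zr - z‖ ^ 2 := by positivity
  rw [inner_sub_left, inner_sub_right v] at hgrowth
  rw [inner_sub_right v]
  linarith
end

section
/- Let ψ_n : E → ℝ ∪ {+∞} be a proper closed convex function, let ψ_s : E → ℝ be continuously differentiable and satisfy ψ_s(u) − ψ_s(y) − ⟨∇ψ_s(y), u − y⟩ ≤ (M/2)‖u − y‖² for some M > 0 and every u, y ∈ E, and set ψ := ψ_s + ψ_n. Let μ ≥ 0, θ ≥ 0, ε ≥ 0, x₀ ∈ E, z ∈ dom ψ_n, and v ∈ E. Define z_r := argmin_{u ∈ E} { ⟨∇ψ_s(z) − v, u⟩ + (M/2)‖u − z‖² + ψ_n(u) } and v_r := v + M(z − z_r) + ∇ψ_s(z_r)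 − ∇ψ_s(z). If Δ_μ(z_r; z, v) ≤ ε and ‖v‖² + 2ε ≤ θ²‖z − x₀‖², then ‖v_r‖ ≤ θ [1 + (M + L_{ψ_s}(z, z_r))/√M] ‖z − x₀‖. -/
open RealInnerProductSpace
open scoped Classical

/-- A real number bounded above by `R + t * Q` for every `t ∈ (0, 1]` is bounded above by `R`. -/
theorem le_of_forall_le_add_mul {P Q R : ℝ} (h : ∀ t : ℝ, 0 < t → t ≤ 1 → P ≤ R + t * Q) :
    P ≤ R := by
  have hlim : Filter.Tendsto (fun t : ℝ => R + t * Q) (nhdsWithin 0 (Set.Ioi 0)) (nhds R) := by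
    have hc : Continuous fun t : ℝ => R + t * Q := by fun_prop
    simpa using (hc.tendsto 0).mono_left nhdsWithin_le_nhds
  refine ge_of_tendsto hlim ?_
  filter_upwards [Ioc_mem_nhdsGT (zero_lt_one : (0 : ℝ) < 1)] with t ht
  exact h t ht.1 ht.2

/-- A minimizer of a linear perturbation of a proximal objective lies in the effective domain, and
the objective grows quadratically away from it. -/
theorem prox_quadratic_growth {E : Type*} [NormedAddCommGroup E] [InnerProductSpace ℝ E]
    {f : E → EReal} {M : ℝ} {g z p : E}
    (hconvex : ∀ x y : E, ∀ t : ℝ, 0 ≤ t → t ≤ 1 →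
      f (t • x + (1 - t) • y) ≤ ((t : ℝ) : EReal) * f x + ((1 - t : ℝ) : EReal) * f y)
    (hp : ∀ u : E, ((⟪g, p⟫ + M / 2 * ‖p - z‖ ^ 2 : ℝ) : EReal) + f p ≤
      ((⟪g, u⟫ + M / 2 * ‖u - z‖ ^ 2 : ℝ) : EReal) + f u)
    {a b : ℝ} (ha : f p = (a : EReal)) (hb : f z = (b : EReal)) :
    M * ‖z - p‖ ^ 2 ≤ ⟪g, z - p⟫ + b - a := by
  refine le_of_forall_le_add_mul (Q := M / 2 * ‖z - p‖ ^ 2) fun t ht ht1 => ?_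
  have hmin := (hp (t • z + (1 - t) • p)).trans
    (add_le_add_right (hconvex z p t ht.le ht1) _)
  rw [ha, hb] at hmin
  norm_cast at hmin
  have hsub : t • z + (1 - t) • p - z = (1 - t) • (p - z) := by module
  rw [hsub, norm_smul, mul_pow, Real.norm_eq_abs, sq_abs, inner_add_right, inner_smul_right,
    inner_smul_right, norm_sub_rev p z] at hmin
  rw [inner_sub_right]
  refine le_of_mul_le_mul_left ?_ ht
  linear_combination hmin

/-- refined residual bound
`‖v_r‖ ≤ θ [1 + (M + L_{ψs}(z, z_r))/√M] ‖z − x₀‖`. -/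
theorem stmt_2 {E : Type*} [NormedAddCommGroup E] [InnerProductSpace ℝ E]
    [FiniteDimensional ℝ E]
    (ψn : E → EReal) (ψs : E → ℝ) (M μ θ ε : ℝ) (x₀ z v zr vr : E)
    -- ψn is proper
    (hproper : ∃ x, ψn x ≠ ⊤) (hnobot : ∀ x, ψn x ≠ ⊥)
    -- ψn is closed (lower semicontinuous)
    (hclosed : LowerSemicontinuous ψn)
    -- ψn is convex
    (hconvex : ∀ x y : E, ∀ t : ℝ, 0 ≤ t → t ≤ 1 →
      ψn (t • x + (1 - t) • y) ≤ ((t : ℝ) : EReal) * ψn x + ((1 - t : ℝ) : EReal) * ψn y)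
    -- ψs is continuously differentiable with curvature bound M
    (hψs : ContDiff ℝ 1 ψs)
    (hM : 0 < M)
    (hcurv : ∀ u y : E, ψs u - ψs y - ⟪gradient ψs y, u - y⟫ ≤ M / 2 * ‖u - y‖ ^ 2)
    (hμ : 0 ≤ μ) (hθ : 0 ≤ θ) (hε : 0 ≤ ε)
    -- z ∈ dom ψn
    (hz : ψn z ≠ ⊤)
    -- z_r is the minimizer of u ↦ ⟨∇ψs(z) − v, u⟩ + (M/2)‖u − z‖² + ψn(u)
    (hzr : ∀ u : E,
      ((⟪gradient ψs z - v, zr⟫ + M / 2 * ‖zr - z‖ ^ 2 : ℝ) : EReal) + ψn zr ≤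
        ((⟪gradient ψs z - v, u⟫ + M / 2 * ‖u - z‖ ^ 2 : ℝ) : EReal) + ψn u)
    -- v_r := v + M(z − z_r) + ∇ψs(z_r) − ∇ψs(z)
    (hvr : vr = v + M • (z - zr) + gradient ψs zr - gradient ψs z)
    -- Δ_μ(z_r; z, v) ≤ ε
    (hΔ : (((ψs z : ℝ) : EReal) + ψn z) - (((ψs zr : ℝ) : EReal) + ψn zr)
        - ((⟪v, z - zr⟫ : ℝ) : EReal) + ((μ / 2 * ‖zr - z‖ ^ 2 : ℝ) : EReal) ≤ (ε : EReal))
    -- ‖v‖² + 2ε ≤ θ²‖z − x₀‖²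
    (hvε : ‖v‖ ^ 2 + 2 * ε ≤ θ ^ 2 * ‖z - x₀‖ ^ 2) :
    ‖vr‖ ≤ θ * (1 + (M + (if z = zr then 0
        else ‖gradient ψs z - gradient ψs zr‖ / ‖z - zr‖)) / Real.sqrt M) * ‖z - x₀‖ := by
  have hzr_top : ψn zr ≠ ⊤ := by
    intro htop
    have h := hzr z
    rw [htop, EReal.coe_add_top, top_le_iff] at h
    exact EReal.add_ne_top (EReal.coe_ne_top _) hz h
  obtain ⟨b, hb⟩ : ∃ b : ℝ, ψn z = (b : EReal) := ⟨_, (EReal.coe_toReal hz (hnobot z)).symm⟩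
  obtain ⟨a, ha⟩ : ∃ a : ℝ, ψn zr = (a : EReal) :=
    ⟨_, (EReal.coe_toReal hzr_top (hnobot zr)).symm⟩
  have hgrowth := prox_quadratic_growth hconvex hzr ha hb
  rw [ha, hb] at hΔ
  norm_cast at hΔ
  have hcurv' := hcurv zr z
  rw [← neg_sub z zr, inner_neg_right, norm_neg] at hcurv'
  rw [inner_sub_left] at hgrowth
  have hμd : 0 ≤ μ / 2 * ‖zr - z‖ ^ 2 := by positivity
  have hdist : M * ‖z - zr‖ ^ 2 ≤ 2 * ε := by linarith
  set L : ℝ := if z = zr then 0 else ‖gradient ψs z - gradient ψs zr‖ / ‖z - zr‖ with hL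
  have hL0 : 0 ≤ L := by rw [hL]; split_ifs <;> positivity
  have hLd : ‖gradient ψs zr - gradient ψs z‖ = L * ‖z - zr‖ := by
    rw [hL, norm_sub_rev]
    split_ifs with h
    · simp [h]
    · rw [div_mul_cancel₀ _ (norm_ne_zero_iff.mpr (sub_ne_zero.mpr h))]
  have hB : 0 ≤ θ * ‖z - x₀‖ := by positivity
  have hv : ‖v‖ ≤ θ * ‖z - x₀‖ := abs_le_of_sq_le_sq' (by linarith [mul_pow θ ‖z - x₀‖ 2]) hB |>.2
  have hsM : 0 < Real.sqrt M := Real.sqrt_pos.mpr hM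
  have hd : Real.sqrt M * ‖z - zr‖ ≤ θ * ‖z - x₀‖ := by
    refine (abs_le_of_sq_le_sq' ?_ hB).2
    rw [mul_pow, Real.sq_sqrt hM.le, mul_pow]
    linarith [sq_nonneg ‖v‖]
  have hd' : ‖z - zr‖ ≤ θ * ‖z - x₀‖ / Real.sqrt M := by
    rwa [le_div_iff₀' hsM]
  calc ‖vr‖ = ‖v + M • (z - zr) + (gradient ψs zr - gradient ψs z)‖ := by rw [hvr, add_sub_assoc]
    _ ≤ ‖v‖ + ‖M • (z - zr)‖ + ‖gradient ψs zr - gradient ψs z‖ := norm_add₃_le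
    _ = ‖v‖ + (M + L) * ‖z - zr‖ := by
      rw [hLd, norm_smul, Real.norm_of_nonneg hM.le]; ring
    _ ≤ θ * ‖z - x₀‖ + (M + L) * (θ * ‖z - x₀‖ / Real.sqrt M) := by gcongr
    _ = θ * (1 + (M + L) / Real.sqrt M) * ‖z - x₀‖ := by ring
end

section
/- Let h : E → ℝ ∪ {+∞} be a proper closed convex function, let z ∈ dom h, let L ≥ 0, and let g : E → ℝ be continuously differentiable with g(u) − g(z) − ⟨∇g(z), u − z⟩ ≤ (L/2)‖u − z‖² for every u ∈ dom h. Suppose ẑ is a minimizer over E of the function u ↦ g(z) + ⟨∇g(z), u − z⟩ + h(u) + (L/2)‖u − z‖². Then (L/2)‖z − ẑ‖² ≤ (g + h)(z) − (g + h)(ẑ). -/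
open RealInnerProductSpace

/-- basic property of the composite gradient step:
`(L/2)‖z − ẑ‖² ≤ (g + h)(z) − (g + h)(ẑ)`. -/
theorem stmt_3 {E : Type*} [NormedAddCommGroup E] [InnerProductSpace ℝ E]
    [FiniteDimensional ℝ E]
    (h : E → EReal) (g : E → ℝ) (L : ℝ) (z zhat : E)
    -- h is proper
    (hproper : ∃ x, h x ≠ ⊤) (hnobot : ∀ x, h x ≠ ⊥)
    -- h is closed (lower semicontinuous)
    (hclosed : LowerSemicontinuous h)
    -- h is convex
    (hconvex : ∀ x y : E, ∀ t : ℝ, 0 ≤ t → t ≤ 1 →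
      h (t • x + (1 - t) • y) ≤ ((t : ℝ) : EReal) * h x + ((1 - t : ℝ) : EReal) * h y)
    -- z ∈ dom h
    (hz : h z ≠ ⊤)
    (hL : 0 ≤ L)
    -- g is continuously differentiable with the descent bound on dom h
    (hg : ContDiff ℝ 1 g)
    (hcurv : ∀ u : E, h u ≠ ⊤ →
      g u - g z - ⟪gradient g z, u - z⟫ ≤ L / 2 * ‖u - z‖ ^ 2)
    -- ẑ minimizes u ↦ g(z) + ⟨∇g(z), u − z⟩ + h(u) + (L/2)‖u − z‖² over E
    (hmin : ∀ u : E,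
      ((g z + ⟪gradient g z, zhat - z⟫ + L / 2 * ‖zhat - z‖ ^ 2 : ℝ) : EReal) + h zhat ≤
        ((g z + ⟪gradient g z, u - z⟫ + L / 2 * ‖u - z‖ ^ 2 : ℝ) : EReal) + h u) :
    ((L / 2 * ‖z - zhat‖ ^ 2 : ℝ) : EReal) ≤
      (((g z : ℝ) : EReal) + h z) - (((g zhat : ℝ) : EReal) + h zhat) := by
  have hzhat : h zhat ≠ ⊤ := by
    intro htop
    have hmz := hmin z
    rw [htop, EReal.coe_add_top, top_le_iff] at hmz
    exact EReal.add_ne_top (EReal.coe_ne_top _) hz hmz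
  have hcz := hcurv zhat hzhat
  obtain ⟨a, ha⟩ : ∃ a : ℝ, (a : EReal) = h z := ⟨_, EReal.coe_toReal hz (hnobot z)⟩
  obtain ⟨b, hb⟩ : ∃ b : ℝ, (b : EReal) = h zhat :=
    ⟨_, EReal.coe_toReal hzhat (hnobot zhat)⟩
  rw [← ha, ← hb, norm_sub_rev z zhat]
  set d := ⟪gradient g z, zhat - z⟫ with hd
  set n := ‖zhat - z‖ ^ 2 with hn
  have hn0 : 0 ≤ n := by positivity
  have hsegment : ∀ t : ℝ, 0 ≤ t → t ≤ 1 →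
      g z + d + L / 2 * n + b ≤
        g z + (1 - t) * d + L / 2 * ((1 - t) ^ 2 * n) + (t * a + (1 - t) * b) := by
    intro t ht0 ht1
    have hm := (hmin (t • z + (1 - t) • zhat)).trans
      (add_le_add_right (hconvex z zhat t ht0 ht1) _)
    have hu : t • z + (1 - t) • zhat - z = (1 - t) • (zhat - z) := by module
    rw [hu, inner_smul_right, norm_smul, mul_pow, Real.norm_eq_abs, sq_abs, ← ha, ← hb] at hm
    exact_mod_cast hm
  have hkey : d + L * n + b ≤ a := by
    by_contra! hlt
    have hLn : 0 ≤ L * n := mul_nonneg hL hn0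
    obtain ⟨c, hc⟩ : ∃ c, c = d + L * n + b - a := ⟨_, rfl⟩
    have hc0 : 0 < c := by linarith
    have hpos : 0 < c + L * n := by linarith
    obtain ⟨t, ht⟩ : ∃ t, t = c / (c + L * n) := ⟨_, rfl⟩
    have ht0 : 0 < t := ht ▸ div_pos hc0 hpos
    have ht1 : t ≤ 1 := by rw [ht, div_le_one hpos]; linarith
    have htc : t * (c + L * n) = c := by rw [ht]; field_simp
    have hseg : t * c ≤ t * (L / 2 * n * t) := by
      rw [hc]
      linarith [hsegment t ht0.le ht1]
    have hdiv := le_of_mul_le_mul_left hseg ht0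
    nlinarith [mul_pos ht0 hc0, mul_nonneg ht0.le hLn]
  have hfinal : L / 2 * n ≤ (g z + a) - (g zhat + b) := by linarith
  exact_mod_cast hfinal
end

section
/- Let p > 1, let k ≥ 1 be an integer, and let a, b ∈ ℝ^k. Then min_{1 ≤ i ≤ k} |a_i b_i| ≤ k^{−p} ‖a‖₁ ‖b‖_{1/(p−1)}, where ‖a‖₁ := ∑_{i=1}^k |a_i| and, for q > 0, ‖b‖_q := (∑_{i=1}^k |b_i|^q)^{1/q}. -/
/-- for `p > 1` and `a, b ∈ ℝ^k`,
`min_{1 ≤ i ≤ k} |a_i b_i| ≤ k^{−p} ‖a‖₁ ‖b‖_{1/(p−1)}`. -/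
theorem stmt_4 (p : ℝ) (hp : 1 < p) (k : ℕ) (hk : 1 ≤ k) (a b : Fin k → ℝ) :
    (⨅ i, |a i * b i|) ≤
      (k : ℝ) ^ (-p) * (∑ i, |a i|) * (∑ i, |b i| ^ (1 / (p - 1))) ^ (p - 1) := by
  have hp0 : 0 < p := by linarith
  have hp1 : p - 1 ≠ 0 := by linarith
  have hk0 : (0 : ℝ) < k := by exact_mod_cast hk
  set m := ⨅ i, |a i * b i| with hm
  have hm0 : 0 ≤ m := Real.iInf_nonneg fun i => abs_nonneg _
  have hmi : ∀ i, m ≤ |a i * b i| := fun i => ciInf_le (Set.finite_range _).bddBelow i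
  set A := ∑ i, |a i| with hA
  set B := ∑ i, |b i| ^ (1 / (p - 1)) with hB
  have hA0 : 0 ≤ A := Finset.sum_nonneg fun i _ => abs_nonneg _
  have hB0 : 0 ≤ B := Finset.sum_nonneg fun i _ => by positivity
  have holder := Real.inner_le_Lp_mul_Lq_of_nonneg Finset.univ
    (Real.HolderConjugate.conjExponent hp) (f := fun i => |a i| ^ (1 / p))
    (g := fun i => |b i| ^ (1 / p)) (fun i _ => by positivity) (fun i _ => by positivity)
  have hfa : ∀ i, (|a i| ^ (1 / p)) ^ p = |a i| := fun i => by
    rw [← Real.rpow_mul (abs_nonneg _), one_div_mul_cancel hp0.ne', Real.rpow_one]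
  have hgb : ∀ i, (|b i| ^ (1 / p)) ^ Real.conjExponent p = |b i| ^ (1 / (p - 1)) := fun i => by
    rw [← Real.rpow_mul (abs_nonneg _), Real.conjExponent]
    congr 1
    field_simp
  simp only [hfa, hgb, ← hA, ← hB] at holder
  have hsum : k * m ^ (1 / p) ≤ A ^ (1 / p) * B ^ (1 / Real.conjExponent p) := by
    refine le_trans ?_ holder
    calc k * m ^ (1 / p) = ∑ _i : Fin k, m ^ (1 / p) := by simp
      _ ≤ _ := Finset.sum_le_sum fun i _ => by
        rw [← Real.mul_rpow (abs_nonneg _) (abs_nonneg _), ← abs_mul]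
        exact Real.rpow_le_rpow hm0 (hmi i) (by positivity)
  have hpow := Real.rpow_le_rpow (by positivity) hsum hp0.le
  have hexp : 1 / Real.conjExponent p * p = p - 1 := by
    rw [Real.conjExponent]
    field_simp
  rw [Real.mul_rpow hk0.le (by positivity), Real.mul_rpow (by positivity) (by positivity),
    ← Real.rpow_mul hm0, ← Real.rpow_mul hA0, ← Real.rpow_mul hB0, hexp,
    one_div_mul_cancel hp0.ne', Real.rpow_one, Real.rpow_one] at hpow
  rw [Real.rpow_neg hk0.le, mul_assoc, inv_mul_eq_div, le_div_iff₀' (by positivity)]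
  exact hpow
end

section
/- Let ψ : E → ℝ ∪ {+∞} be proper, let μ ≥ 0 and B > 0, and let Γ : E → ℝ be a function such that Γ − (μ/2)‖·‖² is affine (i.e., Γ(u) = α + ⟨s, u⟩ + (μ/2)‖u‖² for some α ∈ ℝ and s ∈ E) and Γ(u) ≤ ψ(u) for every u ∈ E. Let y₀ ∈ E, let y be the minimizer over E of u ↦ B·Γ(u) + (1/2)‖u − y₀‖², let x ∈ dom ψ, and define r := (y₀ − y)/B + μ(x − y) and η := ψ(x) − Γ(y) − ⟨r, x − y⟩ + (μ/2)‖x − y‖². Then η ≥ 0 and r ∈ ∂_η(ψ − (μ/2)‖· − x‖²)(x), i.e., ψ(z) − (μ/2)‖z − x‖² ≥ ψ(x) + ⟨r, z − x⟩ − η for every z ∈ E. -/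
open RealInnerProductSpace

/-- Second-order expansion of a quadratic with Hessian `μ • id` around a point. -/
theorem affine_add_sq_expand {E : Type*} [NormedAddCommGroup E] [InnerProductSpace ℝ E]
    (μ : ℝ) (s a w : E) :
    ⟪s, a + w⟫ + μ / 2 * ‖a + w‖ ^ 2 =
      ⟪s, a⟫ + μ / 2 * ‖a‖ ^ 2 + ⟪s + μ • a, w⟫ + μ / 2 * ‖w‖ ^ 2 := by
  rw [norm_add_sq_real, inner_add_right, inner_add_left, real_inner_smul_left]
  ring

/-- A vector `v` is zero if `t ↦ t‖v‖² + (c/2)t²‖v‖²` is nonnegative for some `c > 0`. -/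
theorem eq_zero_of_forall_quadratic_nonneg {E : Type*} [NormedAddCommGroup E]
    {v : E} {c : ℝ} (hc : 0 < c)
    (h : ∀ t : ℝ, 0 ≤ t * ‖v‖ ^ 2 + c / 2 * (t ^ 2 * ‖v‖ ^ 2)) : v = 0 := by
  have h1 := h (-1 / c)
  have h2 : -1 / c * ‖v‖ ^ 2 + c / 2 * ((-1 / c) ^ 2 * ‖v‖ ^ 2) = -(‖v‖ ^ 2 / (2 * c)) := by
    field_simp
    ring
  rw [h2] at h1
  have h3 : ‖v‖ ^ 2 / (2 * c) = 0 := le_antisymm (by linarith) (by positivity)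
  simpa [hc.ne'] using h3

/-- First-order optimality for the prox step of a quadratic with Hessian `μ • id`. -/
theorem gradient_eq_of_forall_prox_le {E : Type*} [NormedAddCommGroup E]
    [InnerProductSpace ℝ E] {μ B α : ℝ} (hμ : 0 ≤ μ) (hB : 0 < B) {s y₀ y : E}
    (hy : ∀ u : E, B * (α + ⟪s, y⟫ + μ / 2 * ‖y‖ ^ 2) + 1 / 2 * ‖y - y₀‖ ^ 2 ≤
      B * (α + ⟪s, u⟫ + μ / 2 * ‖u‖ ^ 2) + 1 / 2 * ‖u - y₀‖ ^ 2) :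
    s + μ • y = (1 / B) • (y₀ - y) := by
  have hv : B • (s + μ • y) + (y - y₀) = 0 := by
    refine eq_zero_of_forall_quadratic_nonneg (c := B * μ + 1) (by positivity) fun t ↦ ?_
    set v := B • (s + μ • y) + (y - y₀) with hv
    have h := hy (y + t • v)
    have h1 := affine_add_sq_expand μ s y (t • v)
    have h2 : ‖y + t • v - y₀‖ ^ 2 =
        ‖y - y₀‖ ^ 2 + 2 * (t * ⟪y - y₀, v⟫) + t ^ 2 * ‖v‖ ^ 2 := by
      rw [add_sub_right_comm, norm_add_sq_real, real_inner_smul_right, norm_smul, mul_pow,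
        Real.norm_eq_abs, sq_abs]
    have h3 : B * ⟪s + μ • y, v⟫ + ⟪y - y₀, v⟫ = ‖v‖ ^ 2 := by
      rw [← real_inner_smul_left, ← inner_add_left, ← hv, real_inner_self_eq_norm_sq]
    rw [add_assoc α ⟪s, y + t • v⟫, h1, h2, real_inner_smul_right, norm_smul, mul_pow,
      Real.norm_eq_abs, sq_abs] at h
    linear_combination h + t * h3
  have h : B • (s + μ • y) = y₀ - y := by
    rw [eq_neg_of_add_eq_zero_left hv, neg_sub]
  rw [← h, smul_smul, one_div_mul_cancel hB.ne', one_smul]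

/-- the R-ACG iterate satisfies `η ≥ 0` and
`r ∈ ∂_η(ψ − (μ/2)‖· − x‖²)(x)`. -/
theorem stmt_6 {E : Type*} [NormedAddCommGroup E] [InnerProductSpace ℝ E]
    [FiniteDimensional ℝ E]
    (ψ : E → EReal)
    -- ψ is proper
    (hproper : ∃ x, ψ x ≠ ⊤) (hnobot : ∀ x, ψ x ≠ ⊥)
    (μ B : ℝ) (hμ : 0 ≤ μ) (hB : 0 < B)
    -- Γ − (μ/2)‖·‖² is affine, i.e. Γ(u) = α + ⟨s, u⟩ + (μ/2)‖u‖²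
    (Γ : E → ℝ) (α : ℝ) (s : E)
    (hΓ : ∀ u : E, Γ u = α + ⟪s, u⟫ + μ / 2 * ‖u‖ ^ 2)
    -- Γ ≤ ψ everywhere
    (hΓψ : ∀ u : E, ((Γ u : ℝ) : EReal) ≤ ψ u)
    (y₀ y : E)
    -- y minimizes u ↦ B·Γ(u) + (1/2)‖u − y₀‖² over E
    (hy : ∀ u : E, B * Γ y + 1 / 2 * ‖y - y₀‖ ^ 2 ≤ B * Γ u + 1 / 2 * ‖u - y₀‖ ^ 2)
    -- x ∈ dom ψ
    (x : E) (hx : ψ x ≠ ⊤)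
    -- r := (y₀ − y)/B + μ(x − y)
    (r : E) (hr : r = (1 / B) • (y₀ - y) + μ • (x - y))
    -- η := ψ(x) − Γ(y) − ⟨r, x − y⟩ + (μ/2)‖x − y‖²
    (η : ℝ) (hη : η = (ψ x).toReal - Γ y - ⟪r, x - y⟫ + μ / 2 * ‖x - y‖ ^ 2) :
    0 ≤ η ∧
      ∀ z : E, ψ x + ((⟪r, z - x⟫ - η : ℝ) : EReal) ≤
        ψ z - ((μ / 2 * ‖z - x‖ ^ 2 : ℝ) : EReal) := by
  obtain rfl : Γ = fun u ↦ α + ⟪s, u⟫ + μ / 2 * ‖u‖ ^ 2 := funext hΓ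
  have hgrad := gradient_eq_of_forall_prox_le hμ hB hy
  have hrx : r = s + μ • x := by
    rw [hr, ← hgrad, smul_sub]
    abel
  lift ψ x to ℝ using ⟨hx, hnobot x⟩ with p hp
  have hpx : α + ⟪s, x⟫ + μ / 2 * ‖x‖ ^ 2 ≤ p := by
    have h := hΓψ x
    rw [← hp] at h
    exact_mod_cast h
  have hη' : η = p - (α + ⟪s, x⟫ + μ / 2 * ‖x‖ ^ 2) := by
    have h := affine_add_sq_expand μ s x (y - x)
    rw [add_sub_cancel, ← hrx, ← neg_sub x y, inner_neg_right, norm_neg] at h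
    rw [hη, EReal.toReal_coe]
    linear_combination -h
  refine ⟨by linarith, fun z ↦ ?_⟩
  have hz : p + (⟪r, z - x⟫ - η) =
      α + ⟪s, z⟫ + μ / 2 * ‖z‖ ^ 2 - μ / 2 * ‖z - x‖ ^ 2 := by
    have h := affine_add_sq_expand μ s x (z - x)
    rw [add_sub_cancel, ← hrx] at h
    linear_combination -h - hη'
  rw [← EReal.coe_add, hz, EReal.coe_sub]
  exact EReal.sub_le_sub (hΓψ z) le_rfl
end

section
/- Let μ ≥ 0 and B > 0, let x, y, y₀ ∈ E, and let p, G ∈ ℝ satisfy B·p ≤ B·G + (1/2)‖y − y₀‖². Define r := (y₀ − y)/B + μ(x − y) and η := p − G − ⟨r, x − y⟩ + (μ/2)‖x − y‖². Then (1/(1 + μB))‖B·r + x − y₀‖² + 2Bη ≤ ‖x − y₀‖². -/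
open RealInnerProductSpace

/-- the R-ACG invariant inequality
`(1/(1 + μB))‖B·r + x − y₀‖² + 2Bη ≤ ‖x − y₀‖²`. -/
theorem stmt_7 {E : Type*} [NormedAddCommGroup E] [InnerProductSpace ℝ E]
    [FiniteDimensional ℝ E]
    (μ B : ℝ) (hμ : 0 ≤ μ) (hB : 0 < B)
    (x y y₀ : E) (p G : ℝ)
    (h : B * p ≤ B * G + 1 / 2 * ‖y - y₀‖ ^ 2)
    (r : E) (hr : r = (1 / B) • (y₀ - y) + μ • (x - y))
    (η : ℝ) (hη : η = p - G - ⟪r, x - y⟫ + μ / 2 * ‖x - y‖ ^ 2) :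
    1 / (1 + μ * B) * ‖B • r + x - y₀‖ ^ 2 + 2 * B * η ≤ ‖x - y₀‖ ^ 2 := by
  have hBne : B ≠ 0 := hB.ne'
  have hpos : 0 < 1 + μ * B := by positivity
  have hshift : B • r + x - y₀ = (1 + μ * B) • (x - y) := by
    rw [hr, smul_add, smul_smul, smul_smul, mul_one_div_cancel hBne]
    module
  have hnorm : 1 / (1 + μ * B) * ‖B • r + x - y₀‖ ^ 2 = (1 + μ * B) * ‖x - y‖ ^ 2 := by
    rw [hshift, norm_smul, Real.norm_of_nonneg hpos.le]
    field_simp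
  have hinner : B * ⟪r, x - y⟫ = ⟪y₀ - y, x - y⟫ + μ * B * ‖x - y‖ ^ 2 := by
    rw [hr, inner_add_left, real_inner_smul_left, real_inner_smul_left,
      real_inner_self_eq_norm_sq]
    field_simp
  have hexpand : ‖x - y₀‖ ^ 2 = ‖y - y₀‖ ^ 2 - 2 * ⟪y₀ - y, x - y⟫ + ‖x - y‖ ^ 2 := by
    rw [norm_sub_rev x y₀, norm_sub_rev y y₀, ← norm_sub_sq_real, sub_sub_sub_cancel_right]
  rw [hnorm, hexpand, hη]
  linarith
end

section
/- Let θ > 0 and set K_θ := 1 + √2/θ. Let μ ≥ 0, B > 0, η ≥ 0, and u, x, x₀ ∈ E satisfy B²/(4(1 + μB)) ≥ K_θ², B/2 ≥ K_θ², and (1/(1 + μB))‖B·u + x − x₀‖² + 2Bη ≤ ‖x − x₀‖². Then ‖u‖² + 2η ≤ θ²‖x − x₀‖². -/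
/-- termination criterion of the R-ACG algorithm: if
`B²/(4(1 + μB)) ≥ K_θ²` and `B/2 ≥ K_θ²` and the invariant inequality holds,
then `‖u‖² + 2η ≤ θ²‖x − x₀‖²`. -/
theorem stmt_8 {E : Type*} [NormedAddCommGroup E] [InnerProductSpace ℝ E]
    [FiniteDimensional ℝ E]
    (θ : ℝ) (hθ : 0 < θ) (K : ℝ) (hK : K = 1 + Real.sqrt 2 / θ)
    (μ B η : ℝ) (hμ : 0 ≤ μ) (hB : 0 < B) (hη : 0 ≤ η)
    (u x x₀ : E)
    (h1 : K ^ 2 ≤ B ^ 2 / (4 * (1 + μ * B)))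
    (h2 : K ^ 2 ≤ B / 2)
    (h3 : 1 / (1 + μ * B) * ‖B • u + x - x₀‖ ^ 2 + 2 * B * η ≤ ‖x - x₀‖ ^ 2) :
    ‖u‖ ^ 2 + 2 * η ≤ θ ^ 2 * ‖x - x₀‖ ^ 2 := by
  have hc : 1 ≤ 1 + μ * B := by nlinarith [mul_nonneg hμ hB.le]
  have hc0 : 0 < 1 + μ * B := by linarith
  have hKθ : K * θ = θ + √2 := by
    rw [hK]
    field_simp
  have hK2 : 2 ≤ K ^ 2 * θ ^ 2 := by
    rw [← mul_pow, hKθ]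
    nlinarith [Real.sq_sqrt (show (0 : ℝ) ≤ 2 by norm_num),
      mul_nonneg hθ.le (Real.sqrt_nonneg 2), sq_nonneg θ]
  have hKpos : 0 < K ^ 2 := by
    rw [hK]
    positivity
  rw [le_div_iff₀ (by positivity)] at h1
  have hBη : 0 ≤ 2 * B * η := by positivity
  have hw : ‖B • u + x - x₀‖ ^ 2 ≤ (1 + μ * B) * ‖x - x₀‖ ^ 2 := by
    have h : 1 / (1 + μ * B) * ‖B • u + x - x₀‖ ^ 2 ≤ ‖x - x₀‖ ^ 2 := by linarith
    rwa [one_div_mul_eq_div, div_le_iff₀' hc0] at h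
  have hη' : 2 * B * η ≤ ‖x - x₀‖ ^ 2 := by
    have : 0 ≤ 1 / (1 + μ * B) * ‖B • u + x - x₀‖ ^ 2 := by positivity
    linarith
  have htri : B * ‖u‖ ≤ ‖B • u + x - x₀‖ + ‖x - x₀‖ := by
    have h := norm_sub_le (B • u + x - x₀) (x - x₀)
    rwa [show B • u + x - x₀ - (x - x₀) = B • u by abel, norm_smul,
      Real.norm_of_nonneg hB.le] at h
  have hBu : (B * ‖u‖) ^ 2 ≤ 4 * (1 + μ * B) * ‖x - x₀‖ ^ 2 := by
    have hsq := pow_le_pow_left₀ (by positivity) htri 2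
    have hd := mul_le_mul_of_nonneg_right hc (sq_nonneg ‖x - x₀‖)
    nlinarith [sq_nonneg (‖B • u + x - x₀‖ - ‖x - x₀‖)]
  have hu : K ^ 2 * ‖u‖ ^ 2 ≤ ‖x - x₀‖ ^ 2 := by
    have h := mul_le_mul_of_nonneg_right h1 (sq_nonneg ‖u‖)
    refine le_of_mul_le_mul_left (a := 4 * (1 + μ * B)) ?_ (by positivity)
    linarith
  have hKη : 4 * (K ^ 2 * η) ≤ ‖x - x₀‖ ^ 2 := by
    have h := mul_le_mul_of_nonneg_right h2 hη
    linarith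
  refine le_of_mul_le_mul_left (a := K ^ 2) ?_ hKpos
  have h := mul_le_mul_of_nonneg_right hK2 (sq_nonneg ‖x - x₀‖)
  linarith [sq_nonneg ‖x - x₀‖]
end

section
/- Let h : E → ℝ ∪ {+∞} be proper closed convex, let f₁, f₂ : E → ℝ be continuously differentiable, and suppose f₁(u) − f₁(w) − ⟨∇f₁(w), u − w⟩ ≤ (M₁/2)‖u − w‖² for every u, w ∈ dom h, where M₁ ∈ ℝ. Set φ := f₁ + f₂ + h. Let λ > 0 and θ ∈ (0,1) satisfy λM₁ + θ² ≤ 1/2. Let y⁻, y ∈ dom h, v ∈ E, and ε ≥ 0, and define ψ(u) := λ[f₁(y⁻) + ⟨∇f₁(y⁻), u − y⁻⟩ + f₂(u) + h(u)] + (1/2)‖u − y⁻‖² and Δ₁(u; y, v) := ψ(y) − ψ(u) − ⟨v, y − u⟩ + (1/2)‖u − y‖². If Δ₁(y⁻; y, v) ≤ ε and ‖v‖² + 2ε ≤ θ²‖y − y⁻‖², then (1/(4λ))‖y⁻ − y‖² ≤ φ(y⁻) − [f₁(y⁻) + ⟨∇f₁(y⁻), y − y⁻⟩ + f₂(y) +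 h(y)] − (M₁/2)‖y − y⁻‖² ≤ φ(y⁻) − φ(y). -/
open RealInnerProductSpace

/-- the IA-ICG descent inequality
`(1/(4λ))‖y⁻ − y‖² ≤ φ(y⁻) − ℓ̃_φ(y; y⁻) − (M₁/2)‖y − y⁻‖² ≤ φ(y⁻) − φ(y)`. -/
theorem stmt_9 {E : Type*} [NormedAddCommGroup E] [InnerProductSpace ℝ E]
    [FiniteDimensional ℝ E]
    (h : E → EReal) (f₁ f₂ : E → ℝ) (M₁ lam θ ε : ℝ)
    -- h is proper closed convex
    (hproper : ∃ x, h x ≠ ⊤) (hnobot : ∀ x, h x ≠ ⊥)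
    (hclosed : LowerSemicontinuous h)
    (hconvex : ∀ x y : E, ∀ t : ℝ, 0 ≤ t → t ≤ 1 →
      h (t • x + (1 - t) • y) ≤ ((t : ℝ) : EReal) * h x + ((1 - t : ℝ) : EReal) * h y)
    -- f₁, f₂ are continuously differentiable, curvature of f₁ on dom h
    (hf₁ : ContDiff ℝ 1 f₁) (hf₂ : ContDiff ℝ 1 f₂)
    (hcurv : ∀ u : E, h u ≠ ⊤ → ∀ w : E, h w ≠ ⊤ →
      f₁ u - f₁ w - ⟪gradient f₁ w, u - w⟫ ≤ M₁ / 2 * ‖u - w‖ ^ 2)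
    (hlam : 0 < lam) (hθ : 0 < θ) (hθ1 : θ < 1)
    (hstep : lam * M₁ + θ ^ 2 ≤ 1 / 2)
    -- y⁻, y ∈ dom h
    (ym y : E) (hym : h ym ≠ ⊤) (hy : h y ≠ ⊤)
    (v : E) (hε : 0 ≤ ε)
    -- ψ(u) := λ[f₁(y⁻) + ⟨∇f₁(y⁻), u − y⁻⟩ + f₂(u) + h(u)] + (1/2)‖u − y⁻‖²
    (ψf : E → EReal)
    (hψf : ∀ u : E, ψf u =
      ((lam * (f₁ ym + ⟪gradient f₁ ym, u - ym⟫ + f₂ u)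
          + 1 / 2 * ‖u - ym‖ ^ 2 : ℝ) : EReal) + ((lam : ℝ) : EReal) * h u)
    -- Δ₁(y⁻; y, v) ≤ ε
    (hΔ : ψf y - ψf ym - ((⟪v, y - ym⟫ : ℝ) : EReal)
        + ((1 / 2 * ‖ym - y‖ ^ 2 : ℝ) : EReal) ≤ ((ε : ℝ) : EReal))
    -- ‖v‖² + 2ε ≤ θ²‖y − y⁻‖²
    (hv : ‖v‖ ^ 2 + 2 * ε ≤ θ ^ 2 * ‖y - ym‖ ^ 2) :
    ((1 / (4 * lam) * ‖ym - y‖ ^ 2 : ℝ) : EReal) ≤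
        (((f₁ ym + f₂ ym : ℝ) : EReal) + h ym)
          - (((f₁ ym + ⟪gradient f₁ ym, y - ym⟫ + f₂ y : ℝ) : EReal) + h y)
          - ((M₁ / 2 * ‖y - ym‖ ^ 2 : ℝ) : EReal)
      ∧ (((f₁ ym + f₂ ym : ℝ) : EReal) + h ym)
          - (((f₁ ym + ⟪gradient f₁ ym, y - ym⟫ + f₂ y : ℝ) : EReal) + h y)
          - ((M₁ / 2 * ‖y - ym‖ ^ 2 : ℝ) : EReal)
        ≤ (((f₁ ym + f₂ ym : ℝ) : EReal) + h ym)
          - (((f₁ y + f₂ y : ℝ) : EReal) + h y) := by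
  obtain ⟨a, ha⟩ : ∃ a : ℝ, h ym = a := ⟨_, (EReal.coe_toReal hym (hnobot ym)).symm⟩
  obtain ⟨b, hb⟩ : ∃ b : ℝ, h y = b := ⟨_, (EReal.coe_toReal hy (hnobot y)).symm⟩
  have hcv := hcurv y hy ym hym
  rw [hψf, hψf, ha, hb] at hΔ
  rw [ha, hb]
  norm_cast at hΔ ⊢
  rw [norm_sub_rev ym y] at hΔ ⊢
  simp only [sub_self, inner_zero_right, norm_zero] at hΔ
  have hin : ⟪v, y - ym⟫ ≤ (‖v‖ ^ 2 + ‖y - ym‖ ^ 2) / 2 := by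
    nlinarith [real_inner_le_norm v (y - ym), sq_nonneg (‖v‖ - ‖y - ym‖)]
  have hd := mul_le_mul_of_nonneg_right hstep (sq_nonneg ‖y - ym‖)
  refine ⟨?_, by linarith⟩
  rw [← mul_le_mul_iff_right₀ hlam]
  have hquarter : lam * (1 / (4 * lam) * ‖y - ym‖ ^ 2) = ‖y - ym‖ ^ 2 / 4 := by
    field_simp
  rw [hquarter]
  linarith
end

section
/- Let h : E → ℝ ∪ {+∞} be proper closed convex, let Ω ⊆ E be a closed convex set with dom h ⊆ Ω, let f₁, f₂ : E → ℝ be continuously differentiable with f₁(w) − f₁(x̃) − ⟨∇f₁(x̃), w − x̃⟩ ≤ (M₁/2)‖w − x̃‖² for every w ∈ dom h (M₁ ∈ ℝ), and set φ := f₁ + f₂ + h. Let λ > 0, let A ≥ 0 and a > 0 satisfy a² = A + a, and set A⁺ := A + a. Let y⁻ ∈ dom h, x ∈ Ω, x̃ := (A·y⁻ + a·x)/A⁺, y ∈ dom h, v ∈ E. Define γ̃(u) := f₁(x̃) + ⟨∇f₁(x̃), u − x̃⟩ + f₂(u) + h(u), γ(u) := γ̃(y) + (1/λ)⟨v + x̃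 − y, u − y⟩, let y⁺ ∈ {y⁻, y} satisfy φ(y⁺) = min{φ(y⁻), φ(y)}, and let x⁺ := argmin_{u ∈ Ω} { λ·a·γ(u) + (1/2)‖u − x‖² }. Then for every u ∈ dom h: A⁺·[ φ(y⁺) + ((1 − λM₁)/(2λ))‖y − x̃‖² − ‖v‖²/(2λ) ] + (1/(2λ))‖u − x⁺‖² ≤ A·γ(y⁻) + a·γ(u) + (1/(2λ))‖u − x‖². -/
open RealInnerProductSpace

lemma nonneg_of_forall_add_mul_nonneg {b c : ℝ} (hc : 0 ≤ c)
    (h : ∀ t : ℝ, 0 < t → t ≤ 1 → 0 ≤ b + t * c) : 0 ≤ b := by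
  by_contra! hb
  have hd : 0 < c - b := by linarith
  have key := h (-b / (c - b)) (div_pos (by linarith) hd) ((div_le_one hd).2 (by linarith))
  have e : b + -b / (c - b) * c = -(b ^ 2 / (c - b)) := by field_simp; ring
  have : 0 < b ^ 2 / (c - b) := div_pos (by nlinarith) hd
  linarith

/-- A minimizer over a convex set of a linear functional plus half the squared distance to `x`
satisfies the three-point inequality. -/
lemma three_point_of_isMinOn {E : Type*} [NormedAddCommGroup E] [InnerProductSpace ℝ E]
    {Ω : Set E} (hΩ : Convex ℝ Ω) {g x p : E} (hp : p ∈ Ω)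
    (hmin : IsMinOn (fun u => ⟪g, u⟫ + 1 / 2 * ‖u - x‖ ^ 2) Ω p) {u : E} (hu : u ∈ Ω) :
    ⟪g, p⟫ + 1 / 2 * ‖p - x‖ ^ 2 + 1 / 2 * ‖u - p‖ ^ 2 ≤ ⟪g, u⟫ + 1 / 2 * ‖u - x‖ ^ 2 := by
  have hvar : 0 ≤ ⟪g, u - p⟫ + ⟪p - x, u - p⟫ := by
    refine nonneg_of_forall_add_mul_nonneg (c := 1 / 2 * ‖u - p‖ ^ 2) (by positivity) ?_
    intro t ht ht1
    have hle := isMinOn_iff.1 hmin _ (hΩ.add_smul_sub_mem hp hu ⟨ht.le, ht1⟩)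
    have e : p + t • (u - p) - x = (p - x) + t • (u - p) := by abel
    simp only [e, inner_add_right, inner_smul_right, norm_add_sq_real, norm_smul,
      Real.norm_eq_abs, mul_pow, sq_abs] at hle
    refine nonneg_of_mul_nonneg_right (a := t) ?_ ht
    linarith
  have e : u - x = (p - x) + (u - p) := by abel
  rw [e, norm_add_sq_real]
  rw [inner_sub_right g] at hvar
  linarith

/-- Completing the square: lower bound for a linear functional with slope `v + x - y`,
regularized around `x`. -/
lemma half_norm_sq_sub_le_inner_add {E : Type*} [NormedAddCommGroup E] [InnerProductSpace ℝ E]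
    (v x y z : E) :
    1 / 2 * ‖y - x‖ ^ 2 - 1 / 2 * ‖v‖ ^ 2 ≤ ⟪v + x - y, z - y⟫ + 1 / 2 * ‖z - x‖ ^ 2 := by
  have hsq : 0 ≤ ‖v + (z - y)‖ ^ 2 := by positivity
  have e : z - x = (z - y) + (y - x) := by abel
  have e' : v + x - y = v - (y - x) := by abel
  rw [norm_add_sq_real] at hsq
  rw [e, e', norm_add_sq_real, inner_sub_left, real_inner_comm (z - y) (y - x)]
  linarith

/-- the DA-ICG sub-descent inequality: for every `u ∈ dom h`,
`A⁺[φ(y⁺) + ((1 − λM₁)/(2λ))‖y − x̃‖² − ‖v‖²/(2λ)] + (1/(2λ))‖u − x⁺‖²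
  ≤ A·γ(y⁻) + a·γ(u) + (1/(2λ))‖u − x‖²`. -/
theorem stmt_13 {E : Type*} [NormedAddCommGroup E] [InnerProductSpace ℝ E]
    [FiniteDimensional ℝ E]
    (h : E → EReal) (Ω : Set E) (f₁ f₂ : E → ℝ) (M₁ lam A a : ℝ)
    -- h is proper closed convex
    (hproper : ∃ x, h x ≠ ⊤) (hnobot : ∀ x, h x ≠ ⊥)
    (hclosed : LowerSemicontinuous h)
    (hconvex : ∀ x y : E, ∀ t : ℝ, 0 ≤ t → t ≤ 1 →
      h (t • x + (1 - t) • y) ≤ ((t : ℝ) : EReal) * h x + ((1 - t : ℝ) : EReal) * h y)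
    -- Ω is closed convex and contains dom h
    (hΩclosed : IsClosed Ω) (hΩconv : Convex ℝ Ω)
    (hdomΩ : ∀ u : E, h u ≠ ⊤ → u ∈ Ω)
    -- f₁, f₂ are continuously differentiable
    (hf₁ : ContDiff ℝ 1 f₁) (hf₂ : ContDiff ℝ 1 f₂)
    (hlam : 0 < lam) (hA : 0 ≤ A) (ha : 0 < a) (haA : a ^ 2 = A + a)
    -- y⁻ ∈ dom h, x ∈ Ω
    (ym : E) (hym : h ym ≠ ⊤) (x : E) (hx : x ∈ Ω)
    -- x̃ := (A·y⁻ + a·x)/A⁺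
    (xt : E) (hxt : xt = (A + a)⁻¹ • (A • ym + a • x))
    -- curvature of f₁ at x̃ over dom h
    (hcurv : ∀ w : E, h w ≠ ⊤ →
      f₁ w - f₁ xt - ⟪gradient f₁ xt, w - xt⟫ ≤ M₁ / 2 * ‖w - xt‖ ^ 2)
    -- y ∈ dom h
    (y : E) (hy : h y ≠ ⊤) (v : E)
    -- γ(u) := γ̃(y) + (1/λ)⟨v + x̃ − y, u − y⟩ where
    -- γ̃(u) := f₁(x̃) + ⟨∇f₁(x̃), u − x̃⟩ + f₂(u) + h(u)
    (gam : E → ℝ)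
    (hgam : ∀ u : E, gam u =
      (f₁ xt + ⟪gradient f₁ xt, y - xt⟫ + f₂ y + (h y).toReal)
        + (1 / lam) * ⟪v + xt - y, u - y⟫)
    -- y⁺ ∈ {y⁻, y} with φ(y⁺) = min{φ(y⁻), φ(y)}
    (yp : E) (hyp : yp = ym ∨ yp = y)
    (hypmin : (((f₁ yp + f₂ yp : ℝ) : EReal) + h yp) =
      min (((f₁ ym + f₂ ym : ℝ) : EReal) + h ym) (((f₁ y + f₂ y : ℝ) : EReal) + h y))
    -- x⁺ := argmin_{u ∈ Ω} { λaγ(u) + (1/2)‖u − x‖² }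
    (xp : E) (hxpΩ : xp ∈ Ω)
    (hxp : ∀ u ∈ Ω, lam * a * gam xp + 1 / 2 * ‖xp - x‖ ^ 2 ≤
      lam * a * gam u + 1 / 2 * ‖u - x‖ ^ 2) :
    ∀ u : E, h u ≠ ⊤ →
      (A + a) * (((((f₁ yp + f₂ yp : ℝ) : EReal) + h yp).toReal)
            + (1 - lam * M₁) / (2 * lam) * ‖y - xt‖ ^ 2 - ‖v‖ ^ 2 / (2 * lam))
          + 1 / (2 * lam) * ‖u - xp‖ ^ 2 ≤
        A * gam ym + a * gam u + 1 / (2 * lam) * ‖u - x‖ ^ 2 := by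
  intro u hu
  set s : E := v + xt - y
  set c : ℝ := f₁ xt + ⟪gradient f₁ xt, y - xt⟫ + f₂ y + (h y).toReal
  have hApos : 0 < A + a := by positivity
  have hphi : ((((f₁ yp + f₂ yp : ℝ) : EReal) + h yp).toReal) ≤
      c + M₁ / 2 * ‖y - xt‖ ^ 2 := by
    have hle : ((f₁ yp + f₂ yp : ℝ) : EReal) + h yp ≤ ((f₁ y + f₂ y : ℝ) : EReal) + h y :=
      hypmin ▸ min_le_right _ _
    have hyp_top : h yp ≠ ⊤ := by rcases hyp with rfl | rfl <;> assumption
    rw [← EReal.coe_toReal hyp_top (hnobot yp), ← EReal.coe_toReal hy (hnobot y),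
      ← EReal.coe_add, ← EReal.coe_add, EReal.coe_le_coe_iff] at hle
    rw [← EReal.coe_toReal hyp_top (hnobot yp), ← EReal.coe_add, EReal.toReal_coe]
    linarith [hcurv y hy]
  have hgam' : ∀ w, lam * a * gam w = lam * a * c - a * ⟪s, y⟫ + ⟪a • s, w⟫ := by
    intro w
    rw [hgam w, inner_sub_right, real_inner_smul_left]
    field_simp
    ring
  have hprox := three_point_of_isMinOn (g := a • s) (x := x) hΩconv hxpΩ
    (isMinOn_iff.2 fun w hw => by linarith [hxp w hw, hgam' w, hgam' xp]) (hdomΩ u hu)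
  set z : E := (A + a)⁻¹ • (A • ym + a • xp) with hz
  have hsq := half_norm_sq_sub_le_inner_add v xt y z
  have hzx : (A + a) * ‖z - xt‖ ^ 2 = ‖xp - x‖ ^ 2 := by
    have e : z - xt = ((A + a)⁻¹ * a) • (xp - x) := by
      rw [hz, hxt]
      module
    rw [e, norm_smul, mul_pow, Real.norm_eq_abs, sq_abs, mul_pow, haA]
    field_simp
  have hzy : (A + a) * ⟪s, z - y⟫ = A * ⟪s, ym - y⟫ + a * ⟪s, xp - y⟫ := by
    rw [hz]
    simp only [inner_sub_right, inner_smul_right, inner_add_right]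
    field_simp
    ring
  have hquad := mul_le_mul_of_nonneg_left hsq hApos.le
  have hphi' := mul_le_mul_of_nonneg_left hphi (mul_pos hlam hApos).le
  have hym_gam : lam * gam ym = lam * c + ⟪s, ym - y⟫ := by
    rw [hgam ym]; field_simp
  rw [real_inner_smul_left, real_inner_smul_left] at hprox
  have hu_gam : lam * gam u = lam * c + ⟪s, u⟫ - ⟪s, y⟫ := by
    rw [hgam u, inner_sub_right]; field_simp; ring
  rw [inner_sub_right s xp y] at hzy
  refine le_of_mul_le_mul_left ?_ hlam
  have hleft : ∀ F : ℝ, lam * ((A + a) * (F + (1 - lam * M₁) / (2 * lam) * ‖y - xt‖ ^ 2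
      - ‖v‖ ^ 2 / (2 * lam)) + 1 / (2 * lam) * ‖u - xp‖ ^ 2) =
      lam * (A + a) * F + (A + a) * ((1 - lam * M₁) / 2 * ‖y - xt‖ ^ 2 - 1 / 2 * ‖v‖ ^ 2)
        + 1 / 2 * ‖u - xp‖ ^ 2 := by
    intro F; field_simp; ring
  have hright : lam * (A * gam ym + a * gam u + 1 / (2 * lam) * ‖u - x‖ ^ 2) =
      A * (lam * gam ym) + a * (lam * gam u) + 1 / 2 * ‖u - x‖ ^ 2 := by
    field_simp
  rw [hleft, hright, hym_gam, hu_gam]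
  linarith
end

section
/- Let h : E → ℝ ∪ {+∞} be proper closed convex, let Ω ⊆ E be a closed convex set with dom h ⊆ Ω, and suppose ‖u − u'‖ ≤ D_h for all u, u' ∈ dom h and ‖w − w'‖ ≤ D_Ω for all w, w' ∈ Ω, with D_h ≤ D_Ω. Let f₁, f₂ : E → ℝ be continuously differentiable with −(m₁/2)‖w − x̃‖² ≤ f₁(w) − f₁(x̃) − ⟨∇f₁(x̃), w − x̃⟩ ≤ (M₁/2)‖w − x̃‖² for every w ∈ dom h (m₁, M₁ ∈ ℝ), set φ := f₁ + f₂ + h and m₁⁺ := max{m₁, 0}. Let λ > 0 and θ ∈ (0,1) satisfy λM₁ + θ² ≤ 1/2. Let A ≥ 0, a > 0 with a² = A + a, A⁺ := A + a; let y⁻ ∈ dom h, x ∈ Ω, x̃ := (A·y⁻ + a·x)/A⁺, y ∈ dom h, v ∈ E, ε ≥ 0 with ‖v‖² + 2ε ≤ θ²‖y − x̃‖². Define γ̃(u) := f₁(x̃) + ⟨∇f₁(x̃), u − x̃⟩ + f₂(u) + h(u), ψ := λγ̃ + (1/2)‖· − x̃‖², Δ₁(s; y, v) := ψ(y) − ψ(s)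 − ⟨v, y − s⟩ + (1/2)‖s − y‖², let y⁺ ∈ {y⁻, y} satisfy φ(y⁺) = min{φ(y⁻), φ(y)}, and let x⁺ := argmin_{u ∈ Ω} { λ·a·γ(u) + (1/2)‖u − x‖² } where γ(u) := γ̃(y) + (1/λ)⟨v + x̃ − y, u − y⟩. Define θ⁻(u) := A[φ(y⁻) − φ(u)] + (1/(2λ))‖u − x‖² and θ⁺(u) := A⁺[φ(y⁺) − φ(u)] + (1/(2λ))‖u − x⁺‖². Then for every u ∈ dom h with Δ₁(u; y, v) ≤ ε and Δ₁(y⁻; y, v) ≤ ε: (A⁺/(4λ))‖y − x̃‖² ≤ m₁⁺(a·D_h² + 2D_Ω²) + θ⁻(u) − θ⁺(u). -/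
open RealInnerProductSpace

/-- Quadratic-growth inequality for the minimizer over a convex set of an affine function plus
`(1/2)‖· - x‖²`. -/
theorem prox_affine_three_point {E : Type*} [NormedAddCommGroup E] [InnerProductSpace ℝ E]
    {Ω : Set E} (hΩ : Convex ℝ Ω) (c : ℝ) (g y x xp : E) (hxpΩ : xp ∈ Ω)
    (hmin : ∀ u ∈ Ω, c + ⟪g, xp - y⟫ + 1 / 2 * ‖xp - x‖ ^ 2 ≤
      c + ⟪g, u - y⟫ + 1 / 2 * ‖u - x‖ ^ 2) (u : E) (hu : u ∈ Ω) :
    c + ⟪g, xp - y⟫ + 1 / 2 * ‖xp - x‖ ^ 2 + 1 / 2 * ‖u - xp‖ ^ 2 ≤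
      c + ⟪g, u - y⟫ + 1 / 2 * ‖u - x‖ ^ 2 := by
  have expand : ∀ t : ℝ, c + ⟪g, xp + t • (u - xp) - y⟫
      + 1 / 2 * ‖xp + t • (u - xp) - x‖ ^ 2 =
      c + ⟪g, xp - y⟫ + 1 / 2 * ‖xp - x‖ ^ 2 + t * (⟪g, u - xp⟫ + ⟪xp - x, u - xp⟫)
        + t ^ 2 * (1 / 2 * ‖u - xp‖ ^ 2) := by
    intro t
    have e1 : xp + t • (u - xp) - y = (xp - y) + t • (u - xp) := by abel
    have e2 : xp + t • (u - xp) - x = (xp - x) + t • (u - xp) := by abel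
    rw [e1, e2, norm_add_sq_real, inner_add_right, inner_smul_right, inner_smul_right, norm_smul,
      mul_pow, Real.norm_eq_abs, sq_abs]
    ring
  have slope_nonneg : 0 ≤ ⟪g, u - xp⟫ + ⟪xp - x, u - xp⟫ := by
    by_contra! hneg
    set b := ⟪g, u - xp⟫ + ⟪xp - x, u - xp⟫
    set q := 1 / 2 * ‖u - xp‖ ^ 2
    have hq0 : 0 ≤ q := by positivity
    have hd : 0 < q - b := by linarith
    set t := -b / (q - b)
    have ht0 : 0 < t := div_pos (by linarith) hd
    have ht1 : t ≤ 1 := (div_le_one hd).2 (by linarith)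
    have hmem := hmin _ (hΩ.add_smul_sub_mem hxpΩ hu ⟨ht0.le, ht1⟩)
    rw [expand t] at hmem
    have htd : t * (q - b) = -b := div_mul_cancel₀ _ hd.ne'
    have key : 0 ≤ b + t * q := by
      refine nonneg_of_mul_nonneg_right (a := t) ?_ ht0
      linarith [mul_add t b (t * q), show t * (t * q) = t ^ 2 * q by ring]
    nlinarith [mul_neg_of_pos_of_neg ht0 hneg]
  have h1 := expand 1
  rw [one_smul, add_sub_cancel] at h1
  linarith

/-- Completing the square: `⟪v, ·⟫ + (1/2)‖·‖²` is bounded below by `-(1/2)‖v‖²`. -/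
theorem prox_affine_lower_bound {E : Type*} [NormedAddCommGroup E] [InnerProductSpace ℝ E]
    (v xt y w : E) :
    1 / 2 * ‖y - xt‖ ^ 2 - 1 / 2 * ‖v‖ ^ 2 ≤
      ⟪v + xt - y, w - y⟫ + 1 / 2 * ‖w - xt‖ ^ 2 := by
  have e1 : w - xt = (w - y) + (y - xt) := by abel
  have e2 : v + xt - y = v - (y - xt) := by abel
  have hsq := sq_nonneg ‖v + (w - y)‖
  rw [norm_add_sq_real] at hsq
  rw [e1, e2, norm_add_sq_real, inner_sub_left v, real_inner_comm (y - xt) (w - y)]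
  linarith

/-- The residual bound `Δ₁(u; y, v) ≤ ε` says that the affine function through `y` with slope
`v + x̃ - y` minorizes `λγ̃` at `u` up to `ε`. -/
theorem prox_residual_identity {E : Type*} [NormedAddCommGroup E] [InnerProductSpace ℝ E]
    (v xt y u : E) :
    1 / 2 * ‖y - xt‖ ^ 2 - 1 / 2 * ‖u - xt‖ ^ 2 - ⟪v, y - u⟫ + 1 / 2 * ‖u - y‖ ^ 2 =
      ⟪v + xt - y, u - y⟫ := by
  have e1 : u - xt = (u - y) + (y - xt) := by abel
  have e2 : v + xt - y = v - (y - xt) := by abel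
  have e3 : y - u = -(u - y) := by abel
  rw [e1, e2, e3, norm_add_sq_real, inner_sub_left v, inner_neg_right,
    real_inner_comm (y - xt) (u - y)]
  ring

/-- Squared-norm estimate for a convex combination. -/
theorem norm_sq_add_smul_le {E : Type*} [NormedAddCommGroup E] [InnerProductSpace ℝ E]
    {A a : ℝ} (hA : 0 ≤ A) (ha : 0 ≤ a) (p q : E) :
    ‖A • p + a • q‖ ^ 2 ≤ (A + a) * (A * ‖p‖ ^ 2 + a * ‖q‖ ^ 2) := by
  have hpq := sq_nonneg ‖p - q‖
  rw [norm_sub_sq_real] at hpq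
  rw [norm_add_sq_real, norm_smul, norm_smul, inner_smul_left, inner_smul_right, mul_pow, mul_pow,
    Real.norm_eq_abs, Real.norm_eq_abs, sq_abs, sq_abs]
  simp only [conj_trivial]
  nlinarith [mul_nonneg (mul_nonneg hA ha) hpq]

/-- Weighted distance to the extrapolation point in terms of the two diameters. -/
theorem extrapolation_dist_bound {E : Type*} [NormedAddCommGroup E] [InnerProductSpace ℝ E]
    {A a Dh DΩ : ℝ} (hA : 0 ≤ A) (ha : 0 < a) (haA : a ^ 2 = A + a) {ym x xt u : E}
    (hxt : (A + a) • xt = A • ym + a • x) (h1 : ‖ym - x‖ ≤ DΩ) (h2 : ‖u - ym‖ ≤ Dh)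
    (h3 : ‖u - x‖ ≤ DΩ) :
    A * ‖ym - xt‖ ^ 2 + a * ‖u - xt‖ ^ 2 ≤ a * Dh ^ 2 + 2 * DΩ ^ 2 := by
  have hP : 0 < A + a := by linarith
  have s1 : ‖ym - x‖ ^ 2 ≤ DΩ ^ 2 := pow_le_pow_left₀ (norm_nonneg _) h1 2
  have s2 : ‖u - ym‖ ^ 2 ≤ Dh ^ 2 := pow_le_pow_left₀ (norm_nonneg _) h2 2
  have s3 : ‖u - x‖ ^ 2 ≤ DΩ ^ 2 := pow_le_pow_left₀ (norm_nonneg _) h3 2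
  have e1 : (A + a) • (ym - xt) = a • (ym - x) := by
    rw [smul_sub, hxt]; module
  have e2 : (A + a) • (u - xt) = A • (u - ym) + a • (u - x) := by
    rw [smul_sub, hxt]; module
  have n1 : (A + a) ^ 2 * ‖ym - xt‖ ^ 2 = (A + a) * ‖ym - x‖ ^ 2 := by
    have := congrArg (fun z => ‖z‖ ^ 2) e1
    simpa only [norm_smul, mul_pow, Real.norm_eq_abs, sq_abs, haA] using this
  have n1' : (A + a) * ‖ym - xt‖ ^ 2 = ‖ym - x‖ ^ 2 :=
    mul_left_cancel₀ hP.ne' (by linarith [n1])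
  have n2 : (A + a) ^ 2 * ‖u - xt‖ ^ 2 ≤ (A + a) * (A * ‖u - ym‖ ^ 2 + a * ‖u - x‖ ^ 2) := by
    have := norm_sq_add_smul_le hA ha.le (u - ym) (u - x)
    rw [← e2] at this
    simpa only [norm_smul, mul_pow, Real.norm_eq_abs, sq_abs] using this
  have n2' : (A + a) * ‖u - xt‖ ^ 2 ≤ A * ‖u - ym‖ ^ 2 + a * ‖u - x‖ ^ 2 :=
    le_of_mul_le_mul_left (by linarith [n2]) hP
  have b1 : A * ‖ym - xt‖ ^ 2 ≤ DΩ ^ 2 := by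
    nlinarith [mul_nonneg ha.le (sq_nonneg ‖ym - xt‖)]
  have b2 : a * ‖u - xt‖ ^ 2 ≤ a * Dh ^ 2 + DΩ ^ 2 := by
    refine le_of_mul_le_mul_left ?_ hP
    have k1 := mul_le_mul_of_nonneg_left n2' ha.le
    have k2 := mul_le_mul_of_nonneg_left s2 (mul_nonneg ha.le hA)
    have k3 := mul_le_mul_of_nonneg_left s3 (sq_nonneg a)
    have k4 : 0 ≤ a ^ 2 * Dh ^ 2 := by positivity
    have k5 : a ^ 2 * DΩ ^ 2 = (A + a) * DΩ ^ 2 := by rw [haA]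
    linarith [mul_add (A + a) (a * Dh ^ 2) (DΩ ^ 2)]
  linarith

/-- key descent inequality of the DA-ICG method: for every `u ∈ dom h`
with `Δ₁(u; y, v) ≤ ε` and `Δ₁(y⁻; y, v) ≤ ε`,
`(A⁺/(4λ))‖y − x̃‖² ≤ m₁⁺(a·D_h² + 2D_Ω²) + θ⁻(u) − θ⁺(u)`. -/
theorem stmt_14 {E : Type*} [NormedAddCommGroup E] [InnerProductSpace ℝ E]
    [FiniteDimensional ℝ E]
    (h : E → EReal) (Ω : Set E) (f₁ f₂ : E → ℝ)
    (m₁ M₁ lam θ ε Dh DΩ A a : ℝ)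
    -- h is proper closed convex
    (hproper : ∃ x, h x ≠ ⊤) (hnobot : ∀ x, h x ≠ ⊥)
    (hclosed : LowerSemicontinuous h)
    (hconvex : ∀ x y : E, ∀ t : ℝ, 0 ≤ t → t ≤ 1 →
      h (t • x + (1 - t) • y) ≤ ((t : ℝ) : EReal) * h x + ((1 - t : ℝ) : EReal) * h y)
    -- Ω is closed convex and contains dom h
    (hΩclosed : IsClosed Ω) (hΩconv : Convex ℝ Ω)
    (hdomΩ : ∀ u : E, h u ≠ ⊤ → u ∈ Ω)
    -- diameter bounds, with Dh ≤ DΩ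
    (hDh : ∀ u : E, h u ≠ ⊤ → ∀ u' : E, h u' ≠ ⊤ → ‖u - u'‖ ≤ Dh)
    (hDΩ : ∀ w ∈ Ω, ∀ w' ∈ Ω, ‖w - w'‖ ≤ DΩ)
    (hDhΩ : Dh ≤ DΩ)
    -- f₁, f₂ are continuously differentiable
    (hf₁ : ContDiff ℝ 1 f₁) (hf₂ : ContDiff ℝ 1 f₂)
    (hlam : 0 < lam) (hθ0 : 0 < θ) (hθ1 : θ < 1)
    (hstep : lam * M₁ + θ ^ 2 ≤ 1 / 2)
    (hA : 0 ≤ A) (ha : 0 < a) (haA : a ^ 2 = A + a)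
    -- y⁻ ∈ dom h, x ∈ Ω
    (ym : E) (hym : h ym ≠ ⊤) (x : E) (hx : x ∈ Ω)
    -- x̃ := (A·y⁻ + a·x)/A⁺
    (xt : E) (hxt : xt = (A + a)⁻¹ • (A • ym + a • x))
    -- two-sided curvature of f₁ at x̃ over dom h
    (hcurv : ∀ w : E, h w ≠ ⊤ →
      -(m₁ / 2) * ‖w - xt‖ ^ 2 ≤ f₁ w - f₁ xt - ⟪gradient f₁ xt, w - xt⟫ ∧
      f₁ w - f₁ xt - ⟪gradient f₁ xt, w - xt⟫ ≤ M₁ / 2 * ‖w - xt‖ ^ 2)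
    -- y ∈ dom h, relative error condition
    (y : E) (hy : h y ≠ ⊤) (v : E) (hε : 0 ≤ ε)
    (hrel : ‖v‖ ^ 2 + 2 * ε ≤ θ ^ 2 * ‖y - xt‖ ^ 2)
    -- ψ := λγ̃ + (1/2)‖· − x̃‖² with γ̃(u) = f₁(x̃) + ⟨∇f₁(x̃), u − x̃⟩ + f₂(u) + h(u)
    (ψf : E → EReal)
    (hψf : ∀ u : E, ψf u =
      ((lam * (f₁ xt + ⟪gradient f₁ xt, u - xt⟫ + f₂ u)
          + 1 / 2 * ‖u - xt‖ ^ 2 : ℝ) : EReal) + ((lam : ℝ) : EReal) * h u)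
    -- γ(u) := γ̃(y) + (1/λ)⟨v + x̃ − y, u − y⟩
    (gam : E → ℝ)
    (hgam : ∀ u : E, gam u =
      (f₁ xt + ⟪gradient f₁ xt, y - xt⟫ + f₂ y + (h y).toReal)
        + (1 / lam) * ⟪v + xt - y, u - y⟫)
    -- y⁺ ∈ {y⁻, y} with φ(y⁺) = min{φ(y⁻), φ(y)}
    (yp : E) (hyp : yp = ym ∨ yp = y)
    (hypmin : (((f₁ yp + f₂ yp : ℝ) : EReal) + h yp) =
      min (((f₁ ym + f₂ ym : ℝ) : EReal) + h ym) (((f₁ y + f₂ y : ℝ) : EReal) + h y))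
    -- x⁺ := argmin_{u ∈ Ω} { λaγ(u) + (1/2)‖u − x‖² }
    (xp : E) (hxpΩ : xp ∈ Ω)
    (hxp : ∀ u ∈ Ω, lam * a * gam xp + 1 / 2 * ‖xp - x‖ ^ 2 ≤
      lam * a * gam u + 1 / 2 * ‖u - x‖ ^ 2) :
    ∀ u : E, h u ≠ ⊤ →
      -- Δ₁(u; y, v) ≤ ε
      (ψf y - ψf u - ((⟪v, y - u⟫ : ℝ) : EReal)
          + ((1 / 2 * ‖u - y‖ ^ 2 : ℝ) : EReal) ≤ ((ε : ℝ) : EReal)) →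
      -- Δ₁(y⁻; y, v) ≤ ε
      (ψf y - ψf ym - ((⟪v, y - ym⟫ : ℝ) : EReal)
          + ((1 / 2 * ‖ym - y‖ ^ 2 : ℝ) : EReal) ≤ ((ε : ℝ) : EReal)) →
      (A + a) / (4 * lam) * ‖y - xt‖ ^ 2 ≤
        max m₁ 0 * (a * Dh ^ 2 + 2 * DΩ ^ 2)
          + (A * ((((f₁ ym + f₂ ym : ℝ) : EReal) + h ym)
                - (((f₁ u + f₂ u : ℝ) : EReal) + h u)).toReal
              + 1 / (2 * lam) * ‖u - x‖ ^ 2)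
          - ((A + a) * ((((f₁ yp + f₂ yp : ℝ) : EReal) + h yp)
                - (((f₁ u + f₂ u : ℝ) : EReal) + h u)).toReal
              + 1 / (2 * lam) * ‖u - xp‖ ^ 2) := by
  intro u hu hΔu hΔym
  have hcoe : ∀ w, h w ≠ ⊤ → h w = (((h w).toReal : ℝ) : EReal) := fun w hw =>
    (EReal.coe_toReal hw (hnobot w)).symm
  have hyp_top : h yp ≠ ⊤ := by rcases hyp with rfl | rfl <;> assumption
  have hP : 0 < A + a := by linarith
  have hxt' : (A + a) • xt = A • ym + a • x := by
    rw [hxt, smul_smul, mul_inv_cancel₀ hP.ne', one_smul]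
  rw [hψf, hψf, hcoe y hy, hcoe u hu] at hΔu
  rw [hψf, hψf, hcoe y hy, hcoe ym hym] at hΔym
  have hφ : f₁ yp + f₂ yp + (h yp).toReal ≤ f₁ y + f₂ y + (h y).toReal := by
    have hle := hypmin.trans_le (min_le_right _ _)
    rw [hcoe y hy, hcoe yp hyp_top] at hle
    exact_mod_cast hle
  rw [hcoe u hu, hcoe ym hym, hcoe yp hyp_top]
  have hgap : ∀ p q r s : ℝ, (((p : ℝ) : EReal) + (q : EReal) - ((r : EReal) + (s : EReal))).toReal
      = p + q - (r + s) := by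
    intro p q r s
    norm_cast
  rw [hgap, hgap]
  generalize (h y).toReal = Hy at *
  generalize (h u).toReal = Hu at *
  generalize (h ym).toReal = Hm at *
  generalize (h yp).toReal = Hp at *
  norm_cast at hΔu hΔym
  have hidu := prox_residual_identity v xt y u
  have hidm := prox_residual_identity v xt y ym
  have hdist := extrapolation_dist_bound hA ha haA hxt' (hDΩ _ (hdomΩ _ hym) _ hx)
    (hDh _ hu _ hym) (hDΩ _ (hdomΩ _ hu) _ hx)
  have hlamgam : ∀ w, lam * gam w =
      lam * (f₁ xt + ⟪gradient f₁ xt, y - xt⟫ + f₂ y + Hy) + ⟪v + xt - y, w - y⟫ := by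
    intro w
    rw [hgam]
    field_simp
  set G := f₁ xt + ⟪gradient f₁ xt, y - xt⟫ + f₂ y + Hy
  have hthree : lam * a * gam xp + 1 / 2 * ‖xp - x‖ ^ 2 + 1 / 2 * ‖u - xp‖ ^ 2 ≤
      lam * a * gam u + 1 / 2 * ‖u - x‖ ^ 2 := by
    have hrw : ∀ w, lam * a * gam w = a * (lam * G) + ⟪a • (v + xt - y), w - y⟫ := by
      intro w
      rw [real_inner_smul_left]
      linear_combination a * hlamgam w
    simp only [hrw] at hxp ⊢
    exact prox_affine_three_point hΩconv _ _ _ _ _ hxpΩ hxp u (hdomΩ u hu)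
  set z := (A + a)⁻¹ • (A • ym + a • xp) with hz
  have hz' : (A + a) • z = A • ym + a • xp := by
    rw [hz, smul_smul, mul_inv_cancel₀ hP.ne', one_smul]
  have hlow := prox_affine_lower_bound v xt y z
  have hzn : (A + a) * ‖z - xt‖ ^ 2 = ‖xp - x‖ ^ 2 := by
    have e : (A + a) • (z - xt) = a • (xp - x) := by
      rw [smul_sub, hz', hxt']; module
    have hn := congrArg (fun z => ‖z‖ ^ 2) e
    simp only [norm_smul, mul_pow, Real.norm_eq_abs, sq_abs, haA] at hn
    exact mul_left_cancel₀ hP.ne' (by linarith)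
  have hzi : (A + a) * ⟪v + xt - y, z - y⟫ =
      A * ⟪v + xt - y, ym - y⟫ + a * ⟪v + xt - y, xp - y⟫ := by
    rw [← real_inner_smul_right, ← real_inner_smul_right, ← real_inner_smul_right,
      ← inner_add_right]
    congr 1
    rw [smul_sub, hz']; module
  have hcy := (hcurv y hy).2
  have hcm := (hcurv ym hym).1
  have hcu := (hcurv u hu).1
  have hmu : (m₁ / 2) * ‖u - xt‖ ^ 2 ≤ max m₁ 0 / 2 * ‖u - xt‖ ^ 2 := by
    gcongr; exact le_max_left _ _
  have hmm : (m₁ / 2) * ‖ym - xt‖ ^ 2 ≤ max m₁ 0 / 2 * ‖ym - xt‖ ^ 2 := by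
    gcongr; exact le_max_left _ _
  set m := max m₁ 0
  have hm0 : 0 ≤ m := le_max_right _ _
  set R := ‖y - xt‖ ^ 2
  have hR0 : 0 ≤ R := by positivity
  have hmodel_u : lam * gam u ≤
      lam * (f₁ u + f₂ u + Hu + m / 2 * ‖u - xt‖ ^ 2) + ε := by
    have := mul_le_mul_of_nonneg_left (show f₁ xt + ⟪gradient f₁ xt, u - xt⟫ + f₂ u + Hu ≤
      f₁ u + f₂ u + Hu + m / 2 * ‖u - xt‖ ^ 2 by linarith) hlam.le
    rw [hlamgam]
    linarith
  have hmodel_m : lam * gam ym ≤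
      lam * (f₁ ym + f₂ ym + Hm + m / 2 * ‖ym - xt‖ ^ 2) + ε := by
    have := mul_le_mul_of_nonneg_left (show f₁ xt + ⟪gradient f₁ xt, ym - xt⟫ + f₂ ym + Hm ≤
      f₁ ym + f₂ ym + Hm + m / 2 * ‖ym - xt‖ ^ 2 by linarith) hlam.le
    rw [hlamgam]
    linarith
  have hGlow : lam * (f₁ yp + f₂ yp + Hp) + 1 / 4 * R ≤
      lam * G + (1 / 2 * R - 1 / 2 * ‖v‖ ^ 2) - ε := by
    have k1 := mul_le_mul_of_nonneg_left
      (show f₁ yp + f₂ yp + Hp ≤ G + M₁ / 2 * R by linarith) hlam.le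
    have k2 := mul_le_mul_of_nonneg_right hstep hR0
    linarith
  have hmain : (A + a) * (lam * (f₁ yp + f₂ yp + Hp) + 1 / 4 * R) + 1 / 2 * ‖u - xp‖ ^ 2 ≤
      A * (lam * (f₁ ym + f₂ ym + Hm)) + a * (lam * (f₁ u + f₂ u + Hu))
        + lam * (m * (a * Dh ^ 2 + 2 * DΩ ^ 2)) + 1 / 2 * ‖u - x‖ ^ 2 := by
    have k1 := mul_le_mul_of_nonneg_left hGlow hP.le
    have k2 := mul_le_mul_of_nonneg_left hlow hP.le
    have k3 := mul_le_mul_of_nonneg_left hmodel_u ha.le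
    have k4 := mul_le_mul_of_nonneg_left hmodel_m hA
    have k5 := mul_le_mul_of_nonneg_left hdist (mul_nonneg hlam.le hm0)
    have k6 : 0 ≤ lam * m * (a * Dh ^ 2 + 2 * DΩ ^ 2) := by positivity
    have k7 : a * (lam * gam xp) = a * (lam * G + ⟪v + xt - y, xp - y⟫) := by rw [hlamgam]
    have k8 : A * (lam * gam ym) = A * (lam * G + ⟪v + xt - y, ym - y⟫) := by rw [hlamgam]
    linarith
  have hid : m * (a * Dh ^ 2 + 2 * DΩ ^ 2)
        + (A * (f₁ ym + f₂ ym + Hm - (f₁ u + f₂ u + Hu)) + 1 / (2 * lam) * ‖u - x‖ ^ 2)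
        - ((A + a) * (f₁ yp + f₂ yp + Hp - (f₁ u + f₂ u + Hu)) + 1 / (2 * lam) * ‖u - xp‖ ^ 2)
        - (A + a) / (4 * lam) * R =
      (A * (lam * (f₁ ym + f₂ ym + Hm)) + a * (lam * (f₁ u + f₂ u + Hu))
        + lam * (m * (a * Dh ^ 2 + 2 * DΩ ^ 2)) + 1 / 2 * ‖u - x‖ ^ 2
        - ((A + a) * (lam * (f₁ yp + f₂ yp + Hp) + 1 / 4 * R) + 1 / 2 * ‖u - xp‖ ^ 2)) / lam := by
    field_simp
    ring
  have hnonneg := div_nonneg (sub_nonneg.2 hmain) hlam.le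
  rw [← hid] at hnonneg
  linarith
end

section
/- Let λ > 0, let φ : E → ℝ ∪ {+∞} be proper with φ_* := inf_{u ∈ E} φ(u) > −∞, and let k ≥ 1 be an integer. Let y₀, y₁, …, y_k ∈ dom φ, v̂₁, …, v̂_k ∈ E, and E₁, …, E_k ≥ 0 satisfy, for every 1 ≤ i ≤ k: ‖v̂_i‖ ≤ E_i ‖y_i − y_{i−1}‖ and φ(y_{i−1}) − φ(y_i) ≥ (1/(4λ))‖y_i − y_{i−1}‖². Then min_{1 ≤ i ≤ k} ‖v̂_i‖ ≤ k^{−3/2} (∑_{i=1}^k E_i) · (4λ[φ(y₀) − φ_*])^{1/2}. -/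
/-- If `m ≤ a i * d i` on a nonempty finite set and `∑ d i ^ 2 ≤ D`, then two applications of
Cauchy-Schwarz bound `m` by `n ^ (-3 / 2) * (∑ a i) * √D`, where `n` is the size of the set. -/
theorem le_card_rpow_mul_sum_mul_sqrt {ι : Type*} (s : Finset ι) (hs : s.Nonempty)
    {a d : ι → ℝ} {m D : ℝ} (ha : ∀ i ∈ s, 0 ≤ a i) (hd : ∀ i ∈ s, 0 ≤ d i) (hm : 0 ≤ m)
    (h : ∀ i ∈ s, m ≤ a i * d i) (hD : ∑ i ∈ s, d i ^ 2 ≤ D) :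
    m ≤ (s.card : ℝ) ^ (-(3 : ℝ) / 2) * (∑ i ∈ s, a i) * √D := by
  have hn : (0 : ℝ) < s.card := by exact_mod_cast hs.card_pos
  have hsqrt : (s.card : ℝ) * √m ≤ ∑ i ∈ s, √(a i * d i) := by
    rw [← nsmul_eq_mul]
    exact s.card_nsmul_le_sum _ _ fun i hi => Real.sqrt_le_sqrt (h i hi)
  have hcs : (∑ i ∈ s, √(a i * d i)) ^ 2 ≤ (∑ i ∈ s, a i) * ∑ i ∈ s, d i :=
    Finset.sum_sq_le_sum_mul_sum_of_sq_le_mul s ha hd fun i hi =>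
      (Real.sq_sqrt (mul_nonneg (ha i hi) (hd i hi))).le
  have hsum : ∑ i ∈ s, d i ≤ √s.card * √D := by
    rw [← Real.sqrt_mul hn.le]
    exact Real.le_sqrt_of_sq_le (sq_sum_le_card_mul_sum_sq.trans (by gcongr))
  have hmain : (s.card : ℝ) ^ 2 * m ≤ (∑ i ∈ s, a i) * (√s.card * √D) := calc
    (s.card : ℝ) ^ 2 * m = (s.card * √m) ^ 2 := by rw [mul_pow, Real.sq_sqrt hm]
    _ ≤ (∑ i ∈ s, √(a i * d i)) ^ 2 := by gcongr
    _ ≤ (∑ i ∈ s, a i) * ∑ i ∈ s, d i := hcs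
    _ ≤ (∑ i ∈ s, a i) * (√s.card * √D) :=
      mul_le_mul_of_nonneg_left hsum (Finset.sum_nonneg ha)
  have hpow : (s.card : ℝ) ^ 2 * (s.card : ℝ) ^ (-(3 : ℝ) / 2) = √s.card := by
    rw [Real.sqrt_eq_rpow, ← Real.rpow_natCast, ← Real.rpow_add hn]
    norm_num
  refine le_of_mul_le_mul_left (hmain.trans_eq ?_) (pow_pos hn 2)
  rw [← hpow]
  ring

/-- IA-ICG residual rate:
`min_{1 ≤ i ≤ k} ‖v̂_i‖ ≤ k^{−3/2}(∑ E_i)·(4λ[φ(y₀) − φ_*])^{1/2}`. -/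
theorem stmt_15 {E : Type*} [NormedAddCommGroup E] [InnerProductSpace ℝ E]
    [FiniteDimensional ℝ E]
    (lam : ℝ) (hlam : 0 < lam)
    (φ : E → EReal)
    -- φ is proper with φ_* = inf φ > −∞
    (hproper : ∃ x, φ x ≠ ⊤) (hnobot : ∀ x, φ x ≠ ⊥)
    (hbdd : ⊥ < ⨅ u, φ u)
    (k : ℕ) (hk : 1 ≤ k)
    (y vhat : ℕ → E) (Ei : ℕ → ℝ)
    -- y₀, …, y_k ∈ dom φ
    (hdom : ∀ i ≤ k, φ (y i) ≠ ⊤)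
    (hEi : ∀ i, 1 ≤ i → i ≤ k → 0 ≤ Ei i)
    -- ‖v̂_i‖ ≤ E_i ‖y_i − y_{i−1}‖
    (hres : ∀ i, 1 ≤ i → i ≤ k → ‖vhat i‖ ≤ Ei i * ‖y i - y (i - 1)‖)
    -- φ(y_{i−1}) − φ(y_i) ≥ (1/(4λ))‖y_i − y_{i−1}‖²
    (hdesc : ∀ i, 1 ≤ i → i ≤ k →
      ((1 / (4 * lam) * ‖y i - y (i - 1)‖ ^ 2 : ℝ) : EReal) ≤ φ (y (i - 1)) - φ (y i)) :
    Finset.inf' (Finset.Icc 1 k) (Finset.nonempty_Icc.mpr hk) (fun i => ‖vhat i‖) ≤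
      (k : ℝ) ^ (-(3 : ℝ) / 2) * (∑ i ∈ Finset.Icc 1 k, Ei i) *
        Real.sqrt (4 * lam * (φ (y 0) - ⨅ u, φ u).toReal) := by
  have hcoe : ∀ i ≤ k, ((φ (y i)).toReal : EReal) = φ (y i) := fun i hi =>
    EReal.coe_toReal (hdom i hi) (hnobot _)
  have hinf : ((⨅ u, φ u).toReal : EReal) = ⨅ u, φ u :=
    EReal.coe_toReal (ne_top_of_le_ne_top (hdom 0 k.zero_le) (iInf_le φ (y 0))) hbdd.ne'
  have hgap : (φ (y 0) - ⨅ u, φ u).toReal = (φ (y 0)).toReal - (⨅ u, φ u).toReal := by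
    rw [← hcoe 0 k.zero_le, ← hinf, ← EReal.coe_sub]
    simp only [EReal.toReal_coe]
  have hle : (⨅ u, φ u).toReal ≤ (φ (y k)).toReal := by
    rw [← EReal.coe_le_coe_iff, hcoe k le_rfl, hinf]
    exact iInf_le φ (y k)
  have hstep : ∀ i, 1 ≤ i → i ≤ k →
      ‖y i - y (i - 1)‖ ^ 2 ≤ 4 * lam * ((φ (y (i - 1))).toReal - (φ (y i)).toReal) := by
    intro i h1 hik
    have h := hdesc i h1 hik
    rw [← hcoe i hik, ← hcoe (i - 1) (by lia), ← EReal.coe_sub, EReal.coe_le_coe_iff,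
      one_div_mul_eq_div, div_le_iff₀ (by positivity)] at h
    linarith
  have htele : ∀ n ≤ k, ∑ i ∈ Finset.Icc 1 n, ‖y i - y (i - 1)‖ ^ 2 ≤
      4 * lam * ((φ (y 0)).toReal - (φ (y n)).toReal) := by
    intro n
    induction n with
    | zero => simp
    | succ n ih =>
      intro hn
      rw [Finset.sum_Icc_succ_top (by lia)]
      have h := hstep (n + 1) (by lia) hn
      rw [Nat.add_sub_cancel] at h ⊢
      linarith [ih (by lia)]
  have key := le_card_rpow_mul_sum_mul_sqrt (Finset.Icc 1 k) (Finset.nonempty_Icc.mpr hk)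
    (a := Ei) (d := fun i => ‖y i - y (i - 1)‖)
    (m := (Finset.Icc 1 k).inf' (Finset.nonempty_Icc.mpr hk) fun i => ‖vhat i‖)
    (D := 4 * lam * (φ (y 0) - ⨅ u, φ u).toReal)
    (fun i hi => hEi i (Finset.mem_Icc.mp hi).1 (Finset.mem_Icc.mp hi).2)
    (fun i _ => norm_nonneg _)
    (Finset.le_inf' _ _ fun i _ => norm_nonneg _)
    (fun i hi => (Finset.inf'_le _ hi).trans
      (hres i (Finset.mem_Icc.mp hi).1 (Finset.mem_Icc.mp hi).2))
    ((htele k le_rfl).trans (by rw [hgap]; gcongr))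
  rwa [Nat.card_Icc, Nat.add_sub_cancel] at key
end

section
/- Let λ > 0, let φ : E → ℝ ∪ {+∞} be proper with φ_* := inf_{u ∈ E} φ(u) > −∞, let ρ̂ > 0 and Ē ≥ 0, and let k ≥ 1 be an integer. Let y₀, y₁, …, y_k ∈ dom φ, v̂₁, …, v̂_k ∈ E, and E₁, …, E_k ∈ [0, Ē] satisfy, for every 1 ≤ i ≤ k: ‖v̂_i‖ ≤ E_i ‖y_i − y_{i−1}‖, φ(y_{i−1}) − φ(y_i) ≥ (1/(4λ))‖y_i − y_{i−1}‖², and ‖v̂_i‖ ≥ ρ̂. Then k ≤ 4λ Ē² [φ(y₀) − φ_*] / ρ̂². -/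
/-- IA-ICG iteration-complexity bound:
if the method has not terminated (`‖v̂_i‖ ≥ ρ̂` for all `i ≤ k`), then
`k ≤ 4λĒ²[φ(y₀) − φ_*]/ρ̂²`. -/
theorem stmt_16 {E : Type*} [NormedAddCommGroup E] [InnerProductSpace ℝ E]
    [FiniteDimensional ℝ E]
    (lam ρ Ebar : ℝ) (hlam : 0 < lam) (hρ : 0 < ρ) (hEbar : 0 ≤ Ebar)
    (φ : E → EReal)
    -- φ is proper with φ_* = inf φ > −∞
    (hproper : ∃ x, φ x ≠ ⊤) (hnobot : ∀ x, φ x ≠ ⊥)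
    (hbdd : ⊥ < ⨅ u, φ u)
    (k : ℕ) (hk : 1 ≤ k)
    (y vhat : ℕ → E) (Ei : ℕ → ℝ)
    -- y₀, …, y_k ∈ dom φ
    (hdom : ∀ i ≤ k, φ (y i) ≠ ⊤)
    (hEi : ∀ i, 1 ≤ i → i ≤ k → 0 ≤ Ei i ∧ Ei i ≤ Ebar)
    -- ‖v̂_i‖ ≤ E_i ‖y_i − y_{i−1}‖
    (hres : ∀ i, 1 ≤ i → i ≤ k → ‖vhat i‖ ≤ Ei i * ‖y i - y (i - 1)‖)
    -- φ(y_{i−1}) − φ(y_i) ≥ (1/(4λ))‖y_i − y_{i−1}‖²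
    (hdesc : ∀ i, 1 ≤ i → i ≤ k →
      ((1 / (4 * lam) * ‖y i - y (i - 1)‖ ^ 2 : ℝ) : EReal) ≤ φ (y (i - 1)) - φ (y i))
    -- ‖v̂_i‖ ≥ ρ̂
    (hbig : ∀ i, 1 ≤ i → i ≤ k → ρ ≤ ‖vhat i‖) :
    (k : ℝ) ≤ 4 * lam * Ebar ^ 2 * (φ (y 0) - ⨅ u, φ u).toReal / ρ ^ 2 := by
  have hinf_top : (⨅ u, φ u) ≠ ⊤ := fun h =>
    hdom 0 (Nat.zero_le k) (top_le_iff.mp (h ▸ iInf_le φ (y 0)))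
  have hcoe : ∀ i ≤ k, (((φ (y i)).toReal : ℝ) : EReal) = φ (y i) := fun i hi =>
    EReal.coe_toReal (hdom i hi) (hnobot _)
  have hinf_coe := EReal.coe_toReal hinf_top hbdd.ne'
  have hinf_le : (⨅ u, φ u).toReal ≤ (φ (y k)).toReal := by
    rw [← EReal.coe_le_coe_iff, hinf_coe, hcoe k le_rfl]
    exact iInf_le φ (y k)
  have hstep : ∀ j, j + 1 ≤ k →
      ρ ^ 2 ≤ 4 * lam * Ebar ^ 2 * ((φ (y j)).toReal - (φ (y (j + 1))).toReal) := by
    intro j hj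
    have hd := hdesc (j + 1) (Nat.le_add_left 1 j) hj
    rw [Nat.add_sub_cancel, ← hcoe j (by lia), ← hcoe (j + 1) hj, ← EReal.coe_sub,
      EReal.coe_le_coe_iff, one_div, inv_mul_le_iff₀ (by positivity)] at hd
    have hρ_le : ρ ≤ Ebar * ‖y (j + 1) - y j‖ :=
      calc ρ ≤ ‖vhat (j + 1)‖ := hbig _ (Nat.le_add_left 1 j) hj
        _ ≤ Ei (j + 1) * ‖y (j + 1) - y j‖ := hres _ (Nat.le_add_left 1 j) hj
        _ ≤ Ebar * ‖y (j + 1) - y j‖ := by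
          gcongr
          exact (hEi _ (Nat.le_add_left 1 j) hj).2
    calc ρ ^ 2 ≤ (Ebar * ‖y (j + 1) - y j‖) ^ 2 := by gcongr
      _ = Ebar ^ 2 * ‖y (j + 1) - y j‖ ^ 2 := mul_pow _ _ _
      _ ≤ Ebar ^ 2 * (4 * lam * ((φ (y j)).toReal - (φ (y (j + 1))).toReal)) := by gcongr
      _ = _ := by ring
  have hsum : ∀ j ≤ k,
      j * ρ ^ 2 ≤ 4 * lam * Ebar ^ 2 * ((φ (y 0)).toReal - (φ (y j)).toReal) := by
    intro j
    induction j with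
    | zero => simp
    | succ j ih =>
      intro hj
      push_cast
      linarith [ih (by lia), hstep j hj]
  rw [le_div_iff₀ (by positivity),
    EReal.toReal_sub (hdom 0 (Nat.zero_le k)) (hnobot _) hinf_top hbdd.ne']
  refine (hsum k le_rfl).trans ?_
  gcongr
end

section
/- Let λ > 0, m⁺ ≥ 0, D_h ≥ 0, D_Ω ≥ 0, and let k ≥ 1 be an integer. Let φ : E → ℝ ∪ {+∞} be proper with φ_* := inf_{u ∈ E} φ(u) > −∞. Let 0 = A₀ ≤ A₁ ≤ … ≤ A_k be reals with a_{i−1} := A_i − A_{i−1}, let y₀^c, y₁^c, …, y_k^c ∈ dom φ satisfy φ(y_{i−1}^c) ≥ φ(y_i^c) for every 1 ≤ i ≤ k, let x₀ = y₀^c and x₁, …, x_k ∈ E satisfy ‖y_i^c − x_{i−1}‖ ≤ D_Ω for every 1 ≤ i ≤ k, and let y_i, x̃_{i−1} ∈ E. Define θ_i(u) := A_i[φ(y_i^c) − φ(u)] + (1/(2λ))‖u − x_i‖². Suppose that for every 1 ≤ i ≤ k: (A_i/(4λ))‖y_i − x̃_{i−1}‖² ≤ m⁺(a_{i−1} D_h²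 + 2D_Ω²) + θ_{i−1}(y_i^c) − θ_i(y_i^c). Then S_k := (1/(4λ)) ∑_{i=1}^k A_i ‖y_i − x̃_{i−1}‖² ≤ m⁺(A_k D_h² + 2k D_Ω²) + A_k[φ(y₀^c) − φ_*] + (k/(2λ)) D_Ω². -/
/-- bound on the weighted displacement sum `S_k` in the DA-ICG method:
`S_k ≤ m⁺(A_k D_h² + 2k D_Ω²) + A_k[φ(y₀^c) − φ_*] + (k/(2λ))D_Ω²`. -/
theorem stmt_17 {E : Type*} [NormedAddCommGroup E] [InnerProductSpace ℝ E]
    [FiniteDimensional ℝ E]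
    (lam mp Dh DΩ : ℝ) (hlam : 0 < lam) (hmp : 0 ≤ mp)
    (hDh : 0 ≤ Dh) (hDΩ : 0 ≤ DΩ)
    (k : ℕ) (hk : 1 ≤ k)
    (φ : E → EReal)
    -- φ is proper with φ_* = inf φ > −∞
    (hproper : ∃ x, φ x ≠ ⊤) (hnobot : ∀ x, φ x ≠ ⊥)
    (hbdd : ⊥ < ⨅ u, φ u)
    -- 0 = A₀ ≤ A₁ ≤ … ≤ A_k, a_{i−1} := A_i − A_{i−1}
    (A a : ℕ → ℝ) (hA0 : A 0 = 0)
    (hAmono : ∀ i, i < k → A i ≤ A (i + 1))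
    (ha : ∀ i, a i = A (i + 1) - A i)
    -- monotone iterates y_i^c ∈ dom φ with nonincreasing values
    (yc : ℕ → E) (hycdom : ∀ i ≤ k, φ (yc i) ≠ ⊤)
    (hφmono : ∀ i, 1 ≤ i → i ≤ k → φ (yc i) ≤ φ (yc (i - 1)))
    -- x₀ = y₀^c and ‖y_i^c − x_{i−1}‖ ≤ D_Ω
    (x : ℕ → E) (hx0 : x 0 = yc 0)
    (hxdist : ∀ i, 1 ≤ i → i ≤ k → ‖yc i - x (i - 1)‖ ≤ DΩ)
    (y xt : ℕ → E)
    -- potential θ_i(u) := A_i[φ(y_i^c) − φ(u)] + (1/(2λ))‖u − x_i‖²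
    (θf : ℕ → E → ℝ)
    (hθf : ∀ i : ℕ, ∀ u : E, θf i u =
      A i * (φ (yc i) - φ u).toReal + 1 / (2 * lam) * ‖u - x i‖ ^ 2)
    -- key descent inequality with u = y_i^c
    (hkey : ∀ i, 1 ≤ i → i ≤ k →
      A i / (4 * lam) * ‖y i - xt (i - 1)‖ ^ 2 ≤
        mp * (a (i - 1) * Dh ^ 2 + 2 * DΩ ^ 2) + θf (i - 1) (yc i) - θf i (yc i)) :
    1 / (4 * lam) * ∑ i ∈ Finset.Icc 1 k, A i * ‖y i - xt (i - 1)‖ ^ 2 ≤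
      mp * (A k * Dh ^ 2 + 2 * k * DΩ ^ 2)
        + A k * (φ (yc 0) - ⨅ u, φ u).toReal + k / (2 * lam) * DΩ ^ 2 := by
  obtain ⟨p, hp⟩ : ∃ p : ℕ → ℝ, ∀ i ≤ k, φ (yc i) = (p i : EReal) :=
    ⟨fun i => (φ (yc i)).toReal, fun i hi =>
      (EReal.coe_toReal (hycdom i hi) (hnobot _)).symm⟩
  have hinf_le : ∀ i, (⨅ u, φ u) ≤ φ (yc i) := fun i => iInf_le _ _
  have hinf_ne_top : (⨅ u, φ u) ≠ ⊤ := by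
    intro h
    exact hycdom 0 (Nat.zero_le k) (top_le_iff.mp (h ▸ hinf_le 0))
  obtain ⟨q, hq⟩ : ∃ q : ℝ, (⨅ u, φ u) = (q : EReal) :=
    ⟨_, (EReal.coe_toReal hinf_ne_top hbdd.ne').symm⟩
  have hqp : q ≤ p k := by
    have h := hinf_le k
    rw [hq, hp k le_rfl] at h
    exact EReal.coe_le_coe_iff.mp h
  have hpmono : ∀ i, i + 1 ≤ k → p (i + 1) ≤ p i := by
    intro i hi
    have h := hφmono (i + 1) (Nat.le_add_left 1 i) hi
    rw [Nat.add_sub_cancel, hp (i + 1) hi, hp i (by omega)] at h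
    exact EReal.coe_le_coe_iff.mp h
  have hAk : ∀ i ≤ k, A i ≤ A k := fun i hi =>
    Nat.decreasingInduction (motive := fun j _ => A j ≤ A k)
      (fun j hj h => (hAmono j hj).trans h) le_rfl hi
  have hAk0 : 0 ≤ A k := hA0 ▸ hAk 0 (Nat.zero_le k)
  have hpartial : ∀ j ≤ k,
      1 / (4 * lam) * ∑ i ∈ Finset.Icc 1 j, A i * ‖y i - xt (i - 1)‖ ^ 2 ≤
        mp * (A j * Dh ^ 2 + 2 * j * DΩ ^ 2) + A k * (p 0 - p j)
          + j / (2 * lam) * DΩ ^ 2 := by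
    intro j
    induction j with
    | zero => intro _; simp [hA0]
    | succ j ih =>
      intro hj
      have hprev := ih (by omega)
      have hstep := hkey (j + 1) (Nat.le_add_left 1 j) hj
      have hdist := hxdist (j + 1) (Nat.le_add_left 1 j) hj
      rw [Nat.add_sub_cancel] at hstep hdist
      rw [hθf, hθf, hp j (by omega), hp (j + 1) hj, ← EReal.coe_sub, ← EReal.coe_sub,
        EReal.toReal_coe, EReal.toReal_coe, ha j] at hstep
      have hsq : 1 / (2 * lam) * ‖yc (j + 1) - x j‖ ^ 2 ≤ 1 / (2 * lam) * DΩ ^ 2 := by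
        gcongr
      have hnonneg : 0 ≤ 1 / (2 * lam) * ‖yc (j + 1) - x (j + 1)‖ ^ 2 := by positivity
      have hgap : A j * (p j - p (j + 1)) ≤ A k * (p j - p (j + 1)) :=
        mul_le_mul_of_nonneg_right (hAk j (by omega)) (sub_nonneg.mpr (hpmono j hj))
      have hsplit : A (j + 1) / (4 * lam) * ‖y (j + 1) - xt j‖ ^ 2 =
          1 / (4 * lam) * (A (j + 1) * ‖y (j + 1) - xt j‖ ^ 2) := by ring
      have hcoef : ((j : ℝ) + 1) / (2 * lam) * DΩ ^ 2 =
          j / (2 * lam) * DΩ ^ 2 + 1 / (2 * lam) * DΩ ^ 2 := by ring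
      rw [Finset.sum_Icc_succ_top (Nat.le_add_left 1 j), mul_add, Nat.add_sub_cancel, ← hsplit]
      push_cast
      rw [hcoef]
      linarith
  have hfinal := hpartial k le_rfl
  rw [hq, hp 0 (Nat.zero_le k), ← EReal.coe_sub, EReal.toReal_coe]
  have hgap : A k * (p 0 - p k) ≤ A k * (p 0 - q) :=
    mul_le_mul_of_nonneg_left (by linarith) hAk0
  linarith
end

section
/- Let λ > 0 and let k ≥ 1 be an integer. Let A₁, …, A_k be reals with A_i ≥ i²/4 for every 1 ≤ i ≤ k, let y_i, x̃_{i−1} ∈ E, v̂_i ∈ E, and E_i ≥ 0 satisfy ‖v̂_i‖ ≤ E_i ‖y_i − x̃_{i−1}‖ for every 1 ≤ i ≤ k, and set S_k := (1/(4λ)) ∑_{i=1}^k A_i ‖y_i − x̃_{i−1}‖². Then min_{1 ≤ i ≤ k} ‖v̂_i‖ ≤ 2^{7/2} k^{−5/2} (∑_{i=1}^k E_i) · (4λ S_k)^{1/2}. -/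
/-- A Hölder-type bound: if `m ≤ f i * g i` on `s`, then `m ^ 2 * #s ^ 3` is at most
`(∑ f) ^ 2 * ∑ g ^ 2`. -/
lemma sq_mul_card_pow_three_le {ι : Type*} (s : Finset ι) {f g : ι → ℝ} {m : ℝ} (hm : 0 ≤ m)
    (hf : ∀ i ∈ s, 0 ≤ f i) (hg : ∀ i ∈ s, 0 ≤ g i) (h : ∀ i ∈ s, m ≤ f i * g i) :
    m ^ 2 * (s.card : ℝ) ^ 3 ≤ (∑ i ∈ s, f i) ^ 2 * ∑ i ∈ s, g i ^ 2 := by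
  rcases s.eq_empty_or_nonempty with rfl | hs
  · simp
  have hn : (0 : ℝ) < s.card := by exact_mod_cast hs.card_pos
  have hcs : (∑ _i ∈ s, √m) ^ 2 ≤ (∑ i ∈ s, f i) * ∑ i ∈ s, g i :=
    Finset.sum_sq_le_sum_mul_sum_of_sq_le_mul s hf hg fun i hi =>
      (Real.sq_sqrt hm).trans_le (h i hi)
  have hmn : m * (s.card : ℝ) ^ 2 ≤ (∑ i ∈ s, f i) * ∑ i ∈ s, g i := by
    rwa [Finset.sum_const, nsmul_eq_mul, mul_pow, Real.sq_sqrt hm, mul_comm] at hcs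
  have hsq : (∑ i ∈ s, g i) ^ 2 ≤ s.card * ∑ i ∈ s, g i ^ 2 := sq_sum_le_card_mul_sum_sq
  refine le_of_mul_le_mul_left ?_ hn
  calc (s.card : ℝ) * (m ^ 2 * (s.card : ℝ) ^ 3) = (m * (s.card : ℝ) ^ 2) ^ 2 := by ring
    _ ≤ ((∑ i ∈ s, f i) * ∑ i ∈ s, g i) ^ 2 := by gcongr
    _ = (∑ i ∈ s, f i) ^ 2 * (∑ i ∈ s, g i) ^ 2 := by ring
    _ ≤ (∑ i ∈ s, f i) ^ 2 * (s.card * ∑ i ∈ s, g i ^ 2) := by gcongr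
    _ = s.card * ((∑ i ∈ s, f i) ^ 2 * ∑ i ∈ s, g i ^ 2) := by ring

/-- DA-ICG residual rate:
`min_{1 ≤ i ≤ k} ‖v̂_i‖ ≤ 2^{7/2} k^{−5/2} (∑ E_i)·(4λ S_k)^{1/2}`. -/
theorem stmt_18 {E : Type*} [NormedAddCommGroup E] [InnerProductSpace ℝ E]
    [FiniteDimensional ℝ E]
    (lam : ℝ) (hlam : 0 < lam)
    (k : ℕ) (hk : 1 ≤ k)
    (A : ℕ → ℝ) (hA : ∀ i, 1 ≤ i → i ≤ k → (i : ℝ) ^ 2 / 4 ≤ A i)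
    (y xt vhat : ℕ → E) (Ei : ℕ → ℝ)
    (hEi : ∀ i, 1 ≤ i → i ≤ k → 0 ≤ Ei i)
    (hres : ∀ i, 1 ≤ i → i ≤ k → ‖vhat i‖ ≤ Ei i * ‖y i - xt (i - 1)‖) :
    Finset.inf' (Finset.Icc 1 k) (Finset.nonempty_Icc.mpr hk) (fun i => ‖vhat i‖) ≤
      2 ^ ((7 : ℝ) / 2) * (k : ℝ) ^ (-(5 : ℝ) / 2) * (∑ i ∈ Finset.Icc 1 k, Ei i) *
        Real.sqrt (4 * lam *
          (1 / (4 * lam) * ∑ i ∈ Finset.Icc 1 k, A i * ‖y i - xt (i - 1)‖ ^ 2)) := by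
  rw [← mul_assoc, mul_one_div_cancel (by positivity), one_mul]
  set m := Finset.inf' (Finset.Icc 1 k) (Finset.nonempty_Icc.mpr hk) (fun i => ‖vhat i‖)
  set S := ∑ i ∈ Finset.Icc 1 k, A i * ‖y i - xt (i - 1)‖ ^ 2
  set a := ∑ i ∈ Finset.Icc 1 k, Ei i
  have hk0 : (0 : ℝ) < k := by exact_mod_cast hk
  have hm0 : 0 ≤ m := Finset.le_inf' _ _ fun i _ => norm_nonneg _
  have hA0 : ∀ i ∈ Finset.Icc 1 k, 0 ≤ A i := fun i hi =>
    le_trans (by positivity) (hA i (Finset.mem_Icc.mp hi).1 (Finset.mem_Icc.mp hi).2)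
  have ha0 : 0 ≤ a := Finset.sum_nonneg fun i hi =>
    hEi i (Finset.mem_Icc.mp hi).1 (Finset.mem_Icc.mp hi).2
  have hS0 : 0 ≤ S := Finset.sum_nonneg fun i hi => mul_nonneg (hA0 i hi) (sq_nonneg _)
  set T := Finset.Icc ((k + 1) / 2) k with hT
  have hTk : T ⊆ Finset.Icc 1 k := Finset.Icc_subset_Icc_left (by omega)
  have hcard : (k : ℝ) / 2 ≤ T.card := by
    have : k ≤ 2 * T.card := by rw [hT, Nat.card_Icc]; omega
    have : (k : ℝ) ≤ 2 * T.card := by exact_mod_cast this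
    linarith
  have haT : ∑ i ∈ T, Ei i ≤ a := Finset.sum_le_sum_of_subset_of_nonneg hTk fun i hi _ =>
    hEi i (Finset.mem_Icc.mp hi).1 (Finset.mem_Icc.mp hi).2
  have haT0 : 0 ≤ ∑ i ∈ T, Ei i := Finset.sum_nonneg fun i hi =>
    hEi i (Finset.mem_Icc.mp (hTk hi)).1 (Finset.mem_Icc.mp (hTk hi)).2
  have hST : (k : ℝ) ^ 2 / 16 * ∑ i ∈ T, ‖y i - xt (i - 1)‖ ^ 2 ≤ S := by
    rw [Finset.mul_sum]
    refine (Finset.sum_le_sum fun i hi => ?_).trans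
      (Finset.sum_le_sum_of_subset_of_nonneg hTk fun i hi _ =>
        mul_nonneg (hA0 i hi) (sq_nonneg _))
    have hi' := Finset.mem_Icc.mp (hTk hi)
    refine mul_le_mul_of_nonneg_right (le_trans ?_ (hA i hi'.1 hi'.2)) (sq_nonneg _)
    have h2 : (k : ℝ) ≤ 2 * i := by
      have := (Finset.mem_Icc.mp hi).1
      exact_mod_cast (by omega : k ≤ 2 * i)
    nlinarith
  have hmain : m ^ 2 * (T.card : ℝ) ^ 3 ≤
      (∑ i ∈ T, Ei i) ^ 2 * ∑ i ∈ T, ‖y i - xt (i - 1)‖ ^ 2 := by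
    refine sq_mul_card_pow_three_le T hm0 (fun i hi => ?_) (fun i _ => norm_nonneg _)
      fun i hi => ?_
    · exact hEi i (Finset.mem_Icc.mp (hTk hi)).1 (Finset.mem_Icc.mp (hTk hi)).2
    · exact (Finset.inf'_le _ (hTk hi)).trans
        (hres i (Finset.mem_Icc.mp (hTk hi)).1 (Finset.mem_Icc.mp (hTk hi)).2)
  have hbound : m ^ 2 * (k : ℝ) ^ 5 ≤ 128 * (a ^ 2 * S) := by
    calc m ^ 2 * (k : ℝ) ^ 5 = 8 * (k : ℝ) ^ 2 * (m ^ 2 * ((k : ℝ) / 2) ^ 3) := by ring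
      _ ≤ 8 * (k : ℝ) ^ 2 * (m ^ 2 * (T.card : ℝ) ^ 3) := by gcongr
      _ ≤ 8 * (k : ℝ) ^ 2 *
          ((∑ i ∈ T, Ei i) ^ 2 * ∑ i ∈ T, ‖y i - xt (i - 1)‖ ^ 2) := by gcongr
      _ = 128 * ((∑ i ∈ T, Ei i) ^ 2 *
          ((k : ℝ) ^ 2 / 16 * ∑ i ∈ T, ‖y i - xt (i - 1)‖ ^ 2)) := by ring
      _ ≤ 128 * (a ^ 2 * S) := by gcongr
  have htwo : ((2 : ℝ) ^ ((7 : ℝ) / 2)) ^ 2 = 128 := by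
    rw [← Real.rpow_mul_natCast (by norm_num)]
    norm_num
  have hpow : ((k : ℝ) ^ (-(5 : ℝ) / 2)) ^ 2 = ((k : ℝ) ^ 5)⁻¹ := by
    rw [← Real.rpow_mul_natCast hk0.le, ← Real.rpow_natCast, ← Real.rpow_neg hk0.le]
    norm_num
  refine le_of_sq_le_sq ?_ (by positivity)
  rw [mul_pow, mul_pow, mul_pow, htwo, hpow, Real.sq_sqrt hS0]
  calc m ^ 2 ≤ 128 * (a ^ 2 * S) / (k : ℝ) ^ 5 := (le_div_iff₀ (by positivity)).mpr hbound
    _ = 128 * ((k : ℝ) ^ 5)⁻¹ * a ^ 2 * S := by ring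
end
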